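/- Let K be an algebraically closed field of characteristic 0 and let n ≥ 2. Suppose the Gelfand–Kirillov conjecture holds for sl_n(K), i.e. there exist natural numbers r, s and a K-algebra isomorphism D(sl_n(K)) ≅ D_{r,s}(K). Then there exists N ∈ ℕ such that for every prime p > N, taking k to be an algebraic closure of 𝔽_p, there exist natural numbers r′, s′ and a k-algebra isomorphism D(sl_n(k)) ≅ D_{r′,s′}(k). (Instance of the paper's reduction theorem at the special linear Lie algebras.) -/

import Mathlib

noncomputable section

/-- Generators of the algebra `A_{r,s}(F)`:  `u_1, …, u_r, v_1, …, v_r, y_1, …, y_s`. -/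
inductive WeylPolyGen (r s : ℕ) : Type
  | u : Fin r → WeylPolyGen r s
  | v : Fin r → WeylPolyGen r s
  | y : Fin s → WeylPolyGen r s

/-- The defining relations of `A_{r,s}(F)`:  `u_i u_j = u_j u_i`, `v_i v_j = v_j v_i`,
`u_i v_j = v_j u_i + δ_{ij}`, and each `y_k` commutes with every generator. -/
inductive WeylPolyRel (F : Type) [Field F] (r s : ℕ) :
    FreeAlgebra F (WeylPolyGen r s) → FreeAlgebra F (WeylPolyGen r s) → Prop
  | uu (i j : Fin r) :
      WeylPolyRel F r s
        (FreeAlgebra.ι F (WeylPolyGen.u i) * FreeAlgebra.ι F (WeylPolyGen.u j))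
        (FreeAlgebra.ι F (WeylPolyGen.u j) * FreeAlgebra.ι F (WeylPolyGen.u i))
  | vv (i j : Fin r) :
      WeylPolyRel F r s
        (FreeAlgebra.ι F (WeylPolyGen.v i) * FreeAlgebra.ι F (WeylPolyGen.v j))
        (FreeAlgebra.ι F (WeylPolyGen.v j) * FreeAlgebra.ι F (WeylPolyGen.v i))
  | uv (i j : Fin r) :
      WeylPolyRel F r s
        (FreeAlgebra.ι F (WeylPolyGen.u i) * FreeAlgebra.ι F (WeylPolyGen.v j))
        (FreeAlgebra.ι F (WeylPolyGen.v j) * FreeAlgebra.ι F (WeylPolyGen.u i)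
          + if i = j then 1 else 0)
  | central (a : Fin s) (z : WeylPolyGen r s) :
      WeylPolyRel F r s
        (FreeAlgebra.ι F (WeylPolyGen.y a) * FreeAlgebra.ι F z)
        (FreeAlgebra.ι F z * FreeAlgebra.ι F (WeylPolyGen.y a))

/-- The algebra `A_{r,s}(F)`, the tensor product of the `r`-th Weyl algebra over `F`
with a polynomial ring in `s` variables. -/
abbrev WeylPolyAlgebra (F : Type) [Field F] (r s : ℕ) : Type :=
  RingQuot (WeylPolyRel F r s)

/-- `f : R →ₐ[F] D` realises the division ring `D` as the (left) Ore division ring of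
fractions of `R`:  `f` is injective and every element of `D` has the form
`(f b)⁻¹ * f a` with `a b : R`, `b ≠ 0`. -/
def IsFractionDivisionRing (F : Type) [Field F] {R D : Type} [Ring R] [Algebra F R]
    [DivisionRing D] [Algebra F D] (f : R →ₐ[F] D) : Prop :=
  Function.Injective f ∧ ∀ d : D, ∃ a b : R, b ≠ 0 ∧ f b * d = f a

/-- A witness to the Gelfand–Kirillov conjecture for the Lie algebra `L` over `F`:
natural numbers `r, s`, a division ring of fractions `D₁` of the universal enveloping
algebra `U(L)`, a division ring of fractions `D₂` of `A_{r,s}(F)`, and an `F`-algebra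
isomorphism `D₁ ≃ D₂`. -/
structure GelfandKirillovWitness (F : Type) [Field F]
    (L : Type) [LieRing L] [LieAlgebra F L] : Type 1 where
  r : ℕ
  s : ℕ
  D₁ : Type
  D₂ : Type
  [div₁ : DivisionRing D₁]
  [div₂ : DivisionRing D₂]
  [alg₁ : Algebra F D₁]
  [alg₂ : Algebra F D₂]
  f₁ : UniversalEnvelopingAlgebra F L →ₐ[F] D₁
  f₂ : WeylPolyAlgebra F r s →ₐ[F] D₂
  frac₁ : IsFractionDivisionRing F f₁
  frac₂ : IsFractionDivisionRing F f₂
  iso : D₁ ≃ₐ[F] D₂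

/-- The Gelfand–Kirillov conjecture holds for the Lie algebra `L` over the field `F`:
the division ring of fractions `D(L)` of `U(L)` is isomorphic, as an `F`-algebra, to
`D_{r,s}(F)` (the division ring of fractions of `A_{r,s}(F)`) for some `r, s`. -/
def GelfandKirillovHolds (F : Type) [Field F]
    (L : Type) [LieRing L] [LieAlgebra F L] : Prop :=
  Nonempty (GelfandKirillovWitness F L)

theorem exists_ringHom_algebraicClosure_zmod (R : Type*) [CommRing R] [IsDomain R] [CharZero R]
    [Algebra.FiniteType ℤ R] :
    ∃ N : ℕ, ∀ (p : ℕ) [Fact p.Prime], N < p → Nonempty (R →+* AlgebraicClosure (ZMod p)) := by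
  have : Algebra.FinitePresentation ℤ R := Algebra.FinitePresentation.of_finiteType.mp inferInstance
  have hopen : IsOpen (Set.range (PrimeSpectrum.comap (algebraMap ℤ R))) :=
    (PrimeSpectrum.isOpenMap_comap_of_hasGoingDown_of_finitePresentation).isOpen_range
  obtain ⟨_, ⟨_, ⟨m, rfl⟩, rfl⟩, hm0, hm⟩ :=
    PrimeSpectrum.isBasis_basic_opens.exists_subset_of_mem_open
      (Set.mem_range_self (f := PrimeSpectrum.comap (algebraMap ℤ R)) (⊥ : PrimeSpectrum R)) hopen
  have hm0' : m ≠ 0 := by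
    rintro rfl
    simp at hm0
  refine ⟨m.natAbs, fun p hp hlt => ?_⟩
  have hpZ : Prime (p : ℤ) := Nat.prime_iff_prime_int.mp hp.out
  let P : PrimeSpectrum ℤ :=
    ⟨Ideal.span {(p : ℤ)}, (Ideal.span_singleton_prime hpZ.ne_zero).mpr hpZ⟩
  have hP : P ∈ (PrimeSpectrum.basicOpen m : Set (PrimeSpectrum ℤ)) := by
    simp only [SetLike.mem_coe, PrimeSpectrum.mem_basicOpen, P, Ideal.mem_span_singleton]
    intro hd
    have := Nat.le_of_dvd (Int.natAbs_pos.mpr hm0') (Int.natCast_dvd.mp hd)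
    omega
  obtain ⟨Q, hQ⟩ := hm hP
  obtain ⟨M, hM, hQM⟩ := Q.asIdeal.exists_le_maximal Q.isPrime.ne_top
  let _ : Field (R ⧸ M) := Ideal.Quotient.field M
  have hpM : (p : R) ∈ M := by
    apply hQM
    have : (p : ℤ) ∈ (PrimeSpectrum.comap (algebraMap ℤ R) Q).asIdeal := by
      rw [hQ]
      exact Ideal.mem_span_singleton_self _
    simpa using this
  have hp0 : (p : R ⧸ M) = 0 := by
    rw [← map_natCast (Ideal.Quotient.mk M), Ideal.Quotient.eq_zero_iff_mem]
    exact hpM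
  have : CharP (R ⧸ M) p := (CharP.charP_iff_prime_eq_zero hp.out).mpr hp0
  let _ : Algebra (ZMod p) (R ⧸ M) := ZMod.algebra _ p
  have : Algebra.FiniteType (ZMod p) (R ⧸ M) :=
    Algebra.FiniteType.of_restrictScalars_finiteType ℤ _ _
  have : Module.Finite (ZMod p) (R ⧸ M) := finite_of_finite_type_of_isJacobsonRing _ _
  exact ⟨((IsAlgClosed.lift : (R ⧸ M) →ₐ[ZMod p] AlgebraicClosure (ZMod p)) : _ →+* _).comp
    (Ideal.Quotient.mk M)⟩

/-- For all large primes `p`, there are maps from `K` to `AlgebraicClosure (ZMod p)` respecting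
finitely many sums and products. -/
theorem exists_partial_ringHom (K : Type*) [Field K] [CharZero K] (t : Finset (K × K)) :
    ∃ N : ℕ, ∀ (p : ℕ) [Fact p.Prime], N < p → ∃ θ : K → AlgebraicClosure (ZMod p),
      θ 0 = 0 ∧ θ 1 = 1 ∧
        ∀ q ∈ t, θ (q.1 + q.2) = θ q.1 + θ q.2 ∧ θ (q.1 * q.2) = θ q.1 * θ q.2 := by
  classical
  let R := Algebra.adjoin ℤ (((t.image Prod.fst ∪ t.image Prod.snd : Finset K)) : Set K)
  have : Algebra.FiniteType ℤ R := by
    rw [← Subalgebra.fg_iff_finiteType]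
    exact ⟨_, rfl⟩
  have : CharZero R := inferInstance
  obtain ⟨N, hN⟩ := exists_ringHom_algebraicClosure_zmod R
  refine ⟨N, fun p _ hp => ?_⟩
  obtain ⟨φ⟩ := hN p hp
  refine ⟨fun x => if hx : x ∈ R then φ ⟨x, hx⟩ else 0, ?_, ?_, ?_⟩
  · exact (dif_pos R.zero_mem).trans (map_zero φ)
  · exact (dif_pos R.one_mem).trans (map_one φ)
  · rintro ⟨x, y⟩ hq
    have hx : x ∈ R := Algebra.subset_adjoin (by simpa using Or.inl ⟨y, hq⟩)
    have hy : y ∈ R := Algebra.subset_adjoin (by simpa using Or.inr ⟨x, hq⟩)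
    simp only [dif_pos hx, dif_pos hy, dif_pos (R.add_mem hx hy), dif_pos (R.mul_mem hx hy)]
    exact ⟨map_add φ ⟨x, hx⟩ ⟨y, hy⟩, map_mul φ ⟨x, hx⟩ ⟨y, hy⟩⟩

open MvPolynomial in
/-- Polynomials all of whose monomials have degree less than `d`. -/
def degLT (F ι : Type*) [Field F] (d : ℕ) : Submodule F (MvPolynomial ι F) where
  carrier := {f | ∀ m : ι →₀ ℕ, d ≤ m.degree → coeff m f = 0}
  zero_mem' := fun _ _ => rfl
  add_mem' := fun hf hg m hm => by rw [coeff_add, hf m hm, hg m hm, add_zero]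
  smul_mem' := fun c f hf m hm => by rw [coeff_smul, hf m hm, smul_zero]

section degLT

open MvPolynomial

variable {F ι : Type*} [Field F]

theorem degLT_mono {d e : ℕ} (h : d ≤ e) : degLT F ι d ≤ degLT F ι e :=
  fun _ hf m hm => hf m (h.trans hm)

theorem monomial_mem_degLT {d : ℕ} {m : ι →₀ ℕ} (h : m.degree < d) (c : F) :
    monomial m c ∈ degLT F ι d := by
  classical
  intro m' hm'
  rw [coeff_monomial, if_neg]
  rintro rfl
  omega

theorem C_mem_degLT (c : F) : (C c : MvPolynomial ι F) ∈ degLT F ι 1 :=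
  monomial_mem_degLT (by simp) c

theorem X_mem_degLT (i : ι) : (X i : MvPolynomial ι F) ∈ degLT F ι 2 :=
  monomial_mem_degLT (by simp) 1

theorem mul_mem_degLT {a b : ℕ} {f g : MvPolynomial ι F} (hf : f ∈ degLT F ι a)
    (hg : g ∈ degLT F ι (b + 1)) : f * g ∈ degLT F ι (a + b) := by
  classical
  intro m hm
  rw [coeff_mul]
  refine Finset.sum_eq_zero fun x hx => ?_
  rw [Finset.HasAntidiagonal.mem_antidiagonal] at hx
  rw [← hx, map_add] at hm
  by_cases h : a ≤ x.1.degree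
  · rw [hf _ h, zero_mul]
  · rw [hg _ (by omega), mul_zero]

theorem mul_mem_degLT' {a b : ℕ} {f g : MvPolynomial ι F} (hf : f ∈ degLT F ι (a + 1))
    (hg : g ∈ degLT F ι b) : f * g ∈ degLT F ι (a + b) := by
  rw [mul_comm, add_comm]
  exact mul_mem_degLT hg hf

theorem prod_X_mem_degLT (l : List ι) :
    (l.map (X : ι → MvPolynomial ι F)).prod ∈ degLT F ι (l.length + 1) := by
  induction l with
  | nil => exact C_mem_degLT 1
  | cons i l ih =>
    rw [List.map_cons, List.prod_cons, List.length_cons, add_comm l.length 1, add_assoc]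
    exact mul_mem_degLT' (X_mem_degLT i) ih

theorem totalDegree_lt_iff {d : ℕ} {f : MvPolynomial ι F} (hf : f ≠ 0) :
    f ∈ degLT F ι d ↔ f.totalDegree < d := by
  constructor
  · intro h
    obtain ⟨m, hm, hd⟩ := Finset.exists_mem_eq_sup f.support (support_nonempty.mpr hf)
      (fun s => s.sum fun _ e => e)
    by_contra hlt
    refine mem_support_iff.mp hm (h m ?_)
    have : f.totalDegree = m.degree := hd
    omega
  · intro h m hm
    refine coeff_eq_zero_of_totalDegree_lt ?_
    rw [Finsupp.degree_apply] at hm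
    exact h.trans_le hm

theorem exists_mem_degLT {f : MvPolynomial ι F} (hf : f ≠ 0) :
    ∃ d, f ∈ degLT F ι (d + 1) ∧ f ∉ degLT F ι d :=
  ⟨f.totalDegree, (totalDegree_lt_iff hf).mpr (Nat.lt_succ_self _),
    fun h => lt_irrefl _ ((totalDegree_lt_iff hf).mp h)⟩

theorem mul_notMem_degLT {a b : ℕ} {f g : MvPolynomial ι F} (hf : f ∉ degLT F ι a)
    (hg : g ∉ degLT F ι b) : f * g ∉ degLT F ι (a + b) := by
  have hf0 : f ≠ 0 := fun h => hf (h ▸ zero_mem _)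
  have hg0 : g ≠ 0 := fun h => hg (h ▸ zero_mem _)
  rw [totalDegree_lt_iff hf0, not_lt] at hf
  rw [totalDegree_lt_iff hg0, not_lt] at hg
  rw [totalDegree_lt_iff (mul_ne_zero hf0 hg0), totalDegree_mul_of_isDomain hf0 hg0]
  omega

end degLT

/-- The span of the products of at most `d` of the generators `X i`. -/
def filt (F : Type*) {ι A : Type*} [Field F] [Ring A] [Algebra F A] (X : ι → A) (d : ℕ) :
    Submodule F A :=
  Submodule.span F (insert 1 (Set.range X)) ^ d

/-- The generators `X i` generate `A` and commute up to affine combinations of themselves. -/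
structure IsQuasiPoly (F : Type*) {ι A : Type*} [Field F] [Ring A] [Algebra F A] (X : ι → A) :
    Prop where
  adjoin_eq_top : Algebra.adjoin F (Set.range X) = ⊤
  commutator_mem : ∀ i j, X i * X j - X j * X i ∈ filt F X 1

/-- The monomial `X ^ μ`, with the factors in an arbitrary but fixed order. -/
noncomputable def orderedMonomial {ι A : Type*} [Ring A] (X : ι → A) (μ : ι →₀ ℕ) : A :=
  ((Finsupp.toMultiset μ).toList.map X).prod

/-- `Φ` maps each product of generators to the corresponding monomial, up to lower order terms. -/
def IsSymbol {F ι A : Type*} [Field F] [Ring A] [Algebra F A] (X : ι → A)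
    (Φ : A →ₗ[F] MvPolynomial ι F) : Prop :=
  ∀ l : List ι, Φ (l.map X).prod - (l.map MvPolynomial.X).prod ∈ degLT F ι l.length

section filt

variable {F ι A : Type*} [Field F] [Ring A] [Algebra F A] {X : ι → A}

theorem filt_add (d e : ℕ) : filt F X (d + e) = filt F X d * filt F X e :=
  pow_add _ _ _

theorem mul_mem_filt {d e : ℕ} {a b : A} (ha : a ∈ filt F X d) (hb : b ∈ filt F X e) :
    a * b ∈ filt F X (d + e) := by
  rw [filt_add]
  exact Submodule.mul_mem_mul ha hb

theorem one_mem_filt_one : (1 : A) ∈ filt F X 1 := by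
  rw [filt, pow_one]
  exact Submodule.subset_span (Set.mem_insert _ _)

theorem gen_mem_filt (i : ι) : X i ∈ filt F X 1 := by
  rw [filt, pow_one]
  exact Submodule.subset_span (Set.mem_insert_of_mem _ ⟨i, rfl⟩)

theorem filt_mono {d e : ℕ} (h : d ≤ e) : filt F X d ≤ filt F X e := by
  induction h with
  | refl => exact le_rfl
  | step _ ih =>
    refine ih.trans fun a ha => ?_
    simpa using mul_mem_filt ha (one_mem_filt_one (F := F) (X := X))

theorem one_mem_filt (d : ℕ) : (1 : A) ∈ filt F X d :=
  filt_mono (Nat.zero_le d) (by rw [filt, pow_zero]; exact Submodule.one_le.mp le_rfl)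

theorem list_prod_mem_filt (l : List ι) : (l.map X).prod ∈ filt F X l.length := by
  induction l with
  | nil => exact one_mem_filt 0
  | cons i l ih =>
    rw [List.map_cons, List.prod_cons, List.length_cons, add_comm]
    exact mul_mem_filt (gen_mem_filt i) ih

theorem filt_le_span_list (d : ℕ) :
    filt F X d ≤ Submodule.span F {a | ∃ l : List ι, l.length ≤ d ∧ (l.map X).prod = a} := by
  induction d with
  | zero =>
    rw [filt, pow_zero, Submodule.one_le]
    exact Submodule.subset_span ⟨[], by simp, by simp⟩
  | succ d ih =>
    rw [filt, pow_succ', Submodule.mul_le]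
    intro a ha b hb
    have hb' := ih hb
    have key := Submodule.mul_mem_mul ha hb'
    rw [Submodule.span_mul_span] at key
    refine Submodule.span_mono ?_ key
    rintro _ ⟨x, hx, _, ⟨l, hl, rfl⟩, rfl⟩
    rcases hx with rfl | ⟨i, rfl⟩
    · exact ⟨l, by omega, by simp⟩
    · exact ⟨i :: l, by simpa using hl, by simp⟩

theorem filt_induction {d : ℕ} {p : A → Prop} {a : A} (ha : a ∈ filt F X d)
    (list : ∀ l : List ι, l.length ≤ d → p (l.map X).prod) (zero : p 0)
    (add : ∀ x y, p x → p y → p (x + y)) (smul : ∀ (c : F) x, p x → p (c • x)) : p a := by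
  refine Submodule.span_induction (p := fun x _ => p x) ?_ zero (fun x y _ _ => add x y)
    (fun c x _ => smul c x) (filt_le_span_list d ha)
  rintro _ ⟨l, hl, rfl⟩
  exact list l hl

theorem IsQuasiPoly.exists_mem_filt (hX : IsQuasiPoly F X) (a : A) : ∃ d, a ∈ filt F X d := by
  have ha : a ∈ Algebra.adjoin F (Set.range X) := hX.adjoin_eq_top ▸ Algebra.mem_top
  induction ha using Algebra.adjoin_induction with
  | mem x hx =>
    obtain ⟨i, rfl⟩ := hx
    exact ⟨1, gen_mem_filt i⟩
  | algebraMap c =>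
    refine ⟨0, ?_⟩
    rw [Algebra.algebraMap_eq_smul_one]
    exact Submodule.smul_mem _ _ (one_mem_filt 0)
  | add x y _ _ hx hy =>
    obtain ⟨d, hd⟩ := hx
    obtain ⟨e, he⟩ := hy
    exact ⟨max d e, add_mem (filt_mono (le_max_left _ _) hd) (filt_mono (le_max_right _ _) he)⟩
  | mul x y _ _ hx hy =>
    obtain ⟨d, hd⟩ := hx
    obtain ⟨e, he⟩ := hy
    exact ⟨d + e, mul_mem_filt hd he⟩

theorem IsQuasiPoly.perm_sub_mem_filt (hX : IsQuasiPoly F X) {l l' : List ι} (h : l.Perm l') :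
    (l.map X).prod - (l'.map X).prod ∈ filt F X (l.length - 1) := by
  induction h with
  | nil => simp
  | @cons i l l' h ih =>
    rw [List.map_cons, List.map_cons, List.prod_cons, List.prod_cons, ← mul_sub]
    rcases l with _ | ⟨j, l⟩
    · rw [List.nil_perm.mp h]
      simp
    · have := mul_mem_filt (gen_mem_filt (F := F) (X := X) i) ih
      rwa [show 1 + ((j :: l).length - 1) = (i :: j :: l).length - 1 by
        simp only [List.length_cons]; omega] at this
  | swap i j l =>
    simp only [List.map_cons, List.prod_cons, ← mul_assoc, ← sub_mul]
    have := mul_mem_filt (hX.commutator_mem j i) (list_prod_mem_filt (F := F) (X := X) l)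
    rwa [add_comm] at this
  | @trans l₁ l₂ l₃ h₁₂ _ ih₁ ih₂ =>
    rw [← h₁₂.length_eq] at ih₂
    simpa using add_mem ih₁ ih₂

theorem IsQuasiPoly.filt_le_span_orderedMonomial (hX : IsQuasiPoly F X) (d : ℕ) :
    filt F X d ≤ Submodule.span F (orderedMonomial X '' {μ | μ.degree ≤ d}) := by
  classical
  induction d using Nat.strong_induction_on with
  | _ d ih =>
    intro a ha
    refine filt_induction ha (fun l hl => ?_) (zero_mem _) (fun _ _ => add_mem)
      (fun c _ => Submodule.smul_mem _ c)
    let μ : ι →₀ ℕ := Multiset.toFinsupp (l : Multiset ι)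
    have hperm : l.Perm (Finsupp.toMultiset μ).toList := by
      rw [← Multiset.coe_eq_coe, Multiset.coe_toList, Multiset.toFinsupp_toMultiset]
    have hdeg : μ.degree = l.length := by
      rw [hperm.length_eq, Multiset.length_toList, Finsupp.card_toMultiset]
      rfl
    have hμ : orderedMonomial X μ ∈ Submodule.span F (orderedMonomial X '' {μ | μ.degree ≤ d}) :=
      Submodule.subset_span ⟨μ, by simpa [hdeg] using hl, rfl⟩
    rcases Nat.eq_zero_or_pos l.length with h0 | hpos
    · have : l.map X = (Finsupp.toMultiset μ).toList.map X := by
        rw [List.length_eq_zero_iff.mp h0] at hperm ⊢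
        rw [List.nil_perm.mp hperm]
      rw [this]
      exact hμ
    · have h1 := ih (l.length - 1) (by omega) (hX.perm_sub_mem_filt hperm)
      have h2 := Submodule.span_mono (R := F) (Set.image_mono (f := orderedMonomial X)
        (fun ν (hν : ν.degree ≤ l.length - 1) => show ν.degree ≤ d by omega)) h1
      have h3 := add_mem h2 hμ
      rwa [orderedMonomial, sub_add_cancel] at h3

theorem IsQuasiPoly.span_orderedMonomial (hX : IsQuasiPoly F X) :
    Submodule.span F (Set.range (orderedMonomial X)) = ⊤ := by
  refine eq_top_iff.mpr fun a _ => ?_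
  obtain ⟨d, hd⟩ := hX.exists_mem_filt a
  exact Submodule.span_mono (Set.image_subset_range _ _) (hX.filt_le_span_orderedMonomial d hd)

theorem orderedMonomial_mem_filt (μ : ι →₀ ℕ) : orderedMonomial X μ ∈ filt F X μ.degree := by
  have := list_prod_mem_filt (F := F) (X := X) (Finsupp.toMultiset μ).toList
  rwa [Multiset.length_toList, Finsupp.card_toMultiset] at this

theorem map_orderedMonomial {B : Type*} [Ring B] (f : A →+* B) (X : ι → A) (μ : ι →₀ ℕ) :
    f (orderedMonomial X μ) = orderedMonomial (fun i => f (X i)) μ := by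
  rw [orderedMonomial, orderedMonomial, map_list_prod, List.map_map]
  rfl

end filt

section symbol

variable {F ι A : Type*} [Field F] [Ring A] [Algebra F A] {X : ι → A}
  {Φ : A →ₗ[F] MvPolynomial ι F}

theorem IsSymbol.map_mem_degLT (hΦ : IsSymbol X Φ) {d : ℕ} {a : A} (ha : a ∈ filt F X d) :
    Φ a ∈ degLT F ι (d + 1) := by
  refine filt_induction (p := fun a => Φ a ∈ degLT F ι (d + 1)) ha (fun l hl => ?_) (by simp)
    (fun x y hx hy => ?_) (fun c x hx => ?_)
  · rw [← sub_add_cancel (Φ (l.map X).prod) (l.map MvPolynomial.X).prod]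
    exact add_mem (degLT_mono (by omega) (hΦ l)) (degLT_mono (by omega) (prod_X_mem_degLT l))
  · rw [map_add]
    exact add_mem hx hy
  · rw [map_smul]
    exact Submodule.smul_mem _ _ hx

theorem IsSymbol.map_mul_sub_mem (hΦ : IsSymbol X Φ) {d e : ℕ} {a b : A} (ha : a ∈ filt F X d)
    (hb : b ∈ filt F X e) : Φ (a * b) - Φ a * Φ b ∈ degLT F ι (d + e) := by
  refine filt_induction (p := fun a => Φ (a * b) - Φ a * Φ b ∈ degLT F ι (d + e)) ha
    (fun l hl => ?_) (by simp) (fun x y hx hy => ?_) (fun c x hx => ?_)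
  · refine filt_induction
      (p := fun b => Φ ((l.map X).prod * b) - Φ (l.map X).prod * Φ b ∈ degLT F ι (d + e)) hb
      (fun l' hl' => ?_) (by simp) (fun x y hx hy => ?_) (fun c x hx => ?_)
    · refine degLT_mono (add_le_add hl hl') ?_
      have h1 := hΦ (l ++ l')
      rw [List.map_append, List.prod_append, List.map_append, List.prod_append,
        List.length_append] at h1
      have h2 := mul_mem_degLT (hΦ l) (hΦ.map_mem_degLT (list_prod_mem_filt l'))
      have h3 := mul_mem_degLT' (prod_X_mem_degLT (F := F) l) (hΦ l')
      convert sub_mem h1 (add_mem h2 h3) using 1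
      ring
    · rw [mul_add, map_add, map_add]
      convert add_mem hx hy using 1
      ring
    · rw [mul_smul_comm, map_smul, map_smul, mul_smul_comm, ← smul_sub]
      exact Submodule.smul_mem _ _ hx
  · rw [add_mul, map_add, map_add]
    convert add_mem hx hy using 1
    ring
  · rw [smul_mul_assoc, map_smul, map_smul, smul_mul_assoc, ← smul_sub]
    exact Submodule.smul_mem _ _ hx

theorem IsSymbol.mul_symbol (hΦ : IsSymbol X Φ) {d e : ℕ} {a b : A} {f g : MvPolynomial ι F}
    (ha : a ∈ filt F X d) (hb : b ∈ filt F X e) (hf : Φ a - f ∈ degLT F ι d)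
    (hg : Φ b - g ∈ degLT F ι e) : Φ (a * b) - f * g ∈ degLT F ι (d + e) := by
  have h1 := hΦ.map_mul_sub_mem ha hb
  have h2 := mul_mem_degLT hf (hΦ.map_mem_degLT hb)
  have hf' : f ∈ degLT F ι (d + 1) := by
    rw [← sub_sub_cancel (Φ a) f]
    exact sub_mem (hΦ.map_mem_degLT ha) (degLT_mono (by omega) hf)
  have h3 := mul_mem_degLT' hf' hg
  convert add_mem h1 (add_mem h2 h3) using 1
  ring

theorem IsSymbol.map_one_sub_mem (hΦ : IsSymbol X Φ) : Φ 1 - 1 ∈ degLT F ι 0 := by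
  simpa using hΦ []

theorem IsSymbol.pow_symbol (hΦ : IsSymbol X Φ) {d : ℕ} {a : A} {f : MvPolynomial ι F}
    (ha : a ∈ filt F X d) (hf : Φ a - f ∈ degLT F ι d) (n : ℕ) :
    a ^ n ∈ filt F X (n * d) ∧ Φ (a ^ n) - f ^ n ∈ degLT F ι (n * d) := by
  induction n with
  | zero => simpa using ⟨one_mem_filt 0, hΦ.map_one_sub_mem⟩
  | succ n ih =>
    rw [pow_succ, pow_succ, Nat.succ_mul]
    exact ⟨mul_mem_filt ih.1 ha, hΦ.mul_symbol ih.1 ha ih.2 hf⟩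

theorem prod_map_X_toList (μ : ι →₀ ℕ) :
    ((Finsupp.toMultiset μ).toList.map (MvPolynomial.X : ι → MvPolynomial ι F)).prod =
      MvPolynomial.monomial μ 1 := by
  rw [← Multiset.prod_coe, ← Multiset.map_coe, Multiset.coe_toList, Finsupp.toMultiset_map,
    Finsupp.prod_toMultiset, Finsupp.prod_mapDomain_index (by simp) (by simp [pow_add]),
    MvPolynomial.monomial_eq]
  simp

theorem IsSymbol.orderedMonomial_symbol (hΦ : IsSymbol X Φ) (μ : ι →₀ ℕ) :
    Φ (orderedMonomial X μ) - MvPolynomial.monomial μ 1 ∈ degLT F ι μ.degree := by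
  have := hΦ (Finsupp.toMultiset μ).toList
  rwa [prod_map_X_toList, Multiset.length_toList, Finsupp.card_toMultiset] at this

/-- A family with symbols the distinct monomials is linearly independent. -/
theorem linearIndependent_of_symbol {y : (ι →₀ ℕ) → A}
    (hy : ∀ μ, Φ (y μ) - MvPolynomial.monomial μ 1 ∈ degLT F ι μ.degree) :
    LinearIndependent F (fun μ => Φ (y μ)) := by
  classical
  rw [linearIndependent_iff]
  intro c hc
  by_contra hne
  obtain ⟨ν, hν, hmax⟩ := Finset.exists_max_image c.support Finsupp.degree
    (Finsupp.support_nonempty_iff.mpr hne)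
  refine Finsupp.mem_support_iff.mp hν ?_
  have h := congrArg (MvPolynomial.coeff ν) hc
  rw [Finsupp.linearCombination_apply, Finsupp.sum, MvPolynomial.coeff_sum,
    Finset.sum_eq_single ν] at h
  · have h1 := hy ν ν le_rfl
    rw [MvPolynomial.coeff_sub, MvPolynomial.coeff_monomial, if_pos rfl, sub_eq_zero] at h1
    rwa [MvPolynomial.coeff_smul, h1, smul_eq_mul, mul_one] at h
  · intro μ hμ hμν
    have h1 := hy μ ν (hmax μ hμ)
    rw [MvPolynomial.coeff_sub, MvPolynomial.coeff_monomial, if_neg hμν, sub_zero] at h1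
    rw [MvPolynomial.coeff_smul, h1, smul_zero]
  · exact fun h' => absurd hν h'

/-- A family with symbols the distinct monomials spans, degree by degree. -/
theorem degLT_le_map_span {y : (ι →₀ ℕ) → A}
    (hy : ∀ μ, Φ (y μ) - MvPolynomial.monomial μ 1 ∈ degLT F ι μ.degree) (d : ℕ) :
    degLT F ι d ≤ (Submodule.span F (y '' {μ | μ.degree < d})).map Φ := by
  classical
  induction d with
  | zero =>
    intro f hf
    rw [show f = 0 from MvPolynomial.ext _ _ fun m => hf m (Nat.zero_le _)]
    exact zero_mem _
  | succ d ih =>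
    have ih' : degLT F ι d ≤ (Submodule.span F (y '' {μ | μ.degree < d + 1})).map Φ :=
      ih.trans (Submodule.map_mono (Submodule.span_mono
        (Set.image_mono fun ν (hν : ν.degree < d) => Nat.lt_succ_of_lt hν)))
    intro f hf
    rw [f.as_sum]
    refine sum_mem fun μ hμ => ?_
    have hμd : μ.degree < d + 1 := by
      by_contra hlt
      exact MvPolynomial.mem_support_iff.mp hμ (hf μ (by omega))
    have h1 : Φ (y μ) ∈ (Submodule.span F (y '' {μ | μ.degree < d + 1})).map Φ :=
      Submodule.mem_map_of_mem (Submodule.subset_span ⟨μ, hμd, rfl⟩)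
    have h2 := sub_mem h1 (ih' (degLT_mono (by omega) (hy μ)))
    rw [sub_sub_cancel] at h2
    have h3 := Submodule.smul_mem _ (MvPolynomial.coeff μ f) h2
    rwa [MvPolynomial.smul_monomial, smul_eq_mul, mul_one] at h3

theorem IsSymbol.injective (hΦ : IsSymbol X Φ) (hX : IsQuasiPoly F X) :
    Function.Injective Φ := by
  rw [injective_iff_map_eq_zero]
  intro a ha
  have hmem : a ∈ Submodule.span F (Set.range (orderedMonomial X)) :=
    hX.span_orderedMonomial ▸ Submodule.mem_top
  obtain ⟨c, rfl⟩ := (Finsupp.mem_span_range_iff_exists_finsupp).mp hmem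
  have hli := linearIndependent_of_symbol hΦ.orderedMonomial_symbol
  rw [linearIndependent_iff] at hli
  have hc : c = 0 := by
    apply hli
    rw [← ha, Finsupp.linearCombination_apply, Finsupp.sum, Finsupp.sum, map_sum]
    simp_rw [map_smul]
  rw [hc, Finsupp.sum_zero_index]

theorem IsSymbol.span_eq_top (hΦ : IsSymbol X Φ) (hX : IsQuasiPoly F X) {y : (ι →₀ ℕ) → A}
    (hy : ∀ μ, Φ (y μ) - MvPolynomial.monomial μ 1 ∈ degLT F ι μ.degree) :
    Submodule.span F (Set.range y) = ⊤ := by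
  refine eq_top_iff.mpr fun a _ => ?_
  obtain ⟨d, hd⟩ := hX.exists_mem_filt a
  obtain ⟨b, hb, hba⟩ := degLT_le_map_span hy (d + 1) (hΦ.map_mem_degLT hd)
  rw [← hΦ.injective hX hba]
  exact Submodule.span_mono (Set.image_subset_range _ _) hb

theorem IsSymbol.mem_filt (hΦ : IsSymbol X Φ) (hX : IsQuasiPoly F X) {d : ℕ} {a : A}
    (ha : Φ a ∈ degLT F ι (d + 1)) : a ∈ filt F X d := by
  obtain ⟨b, hb, hba⟩ := degLT_le_map_span hΦ.orderedMonomial_symbol (d + 1) ha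
  rw [← hΦ.injective hX hba]
  refine Submodule.span_le.mpr ?_ hb
  rintro _ ⟨μ, hμ, rfl⟩
  exact filt_mono (Nat.lt_succ_iff.mp hμ) (orderedMonomial_mem_filt μ)

theorem IsSymbol.nontrivial (hΦ : IsSymbol X Φ) : Nontrivial A := by
  refine ⟨1, 0, fun h => ?_⟩
  have h1 := hΦ.map_one_sub_mem 0 (Nat.zero_le _)
  rw [h, map_zero, zero_sub, MvPolynomial.coeff_neg, MvPolynomial.coeff_zero_one] at h1
  simp at h1

theorem IsSymbol.noZeroDivisors (hΦ : IsSymbol X Φ) (hX : IsQuasiPoly F X) :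
    NoZeroDivisors A where
  eq_zero_or_eq_zero_of_mul_eq_zero := by
    intro a b hab
    by_contra! h
    have hinj := hΦ.injective hX
    obtain ⟨d, hd, hd'⟩ := exists_mem_degLT ((map_ne_zero_iff Φ hinj).mpr h.1)
    obtain ⟨e, he, he'⟩ := exists_mem_degLT ((map_ne_zero_iff Φ hinj).mpr h.2)
    have h1 := hΦ.map_mul_sub_mem (hΦ.mem_filt hX hd) (hΦ.mem_filt hX he)
    rw [hab, map_zero, zero_sub, neg_mem_iff] at h1
    exact mul_notMem_degLT hd' he' h1

end symbol

open MvPolynomial in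
/-- `Z` embeds a polynomial ring in the center of `A`, and `A` is finite over its image. -/
structure IsFiniteOverCentral {F ι A : Type*} [Field F] [Ring A] [Algebra F A]
    (Z : MvPolynomial ι F →ₐ[F] A) : Prop where
  injective : Function.Injective Z
  commute : ∀ f a, Z f * a = a * Z f
  finite : ∃ S : Finset A, ∀ a, ∃ g : A → MvPolynomial ι F, a = ∑ s ∈ S, Z (g s) * s

section central

variable {F ι A : Type*} [Field F] [Ring A] [Algebra F A]

theorem IsFiniteOverCentral.exists_mul_eq [NoZeroDivisors A] {Z : MvPolynomial ι F →ₐ[F] A}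
    (hZ : IsFiniteOverCentral Z) {a : A} (ha : a ≠ 0) :
    ∃ (b : A) (f : MvPolynomial ι F), f ≠ 0 ∧ b * a = Z f := by
  let _ : Algebra (MvPolynomial ι F) A := Z.toRingHom.toAlgebra' hZ.commute
  have hmap : ∀ f, algebraMap (MvPolynomial ι F) A f = Z f := fun _ => rfl
  have hfin : Module.Finite (MvPolynomial ι F) A := by
    obtain ⟨S, hS⟩ := hZ.finite
    refine ⟨⟨S, eq_top_iff.mpr fun x _ => ?_⟩⟩
    obtain ⟨g, hg⟩ := hS x
    rw [hg]
    refine sum_mem fun s hs => ?_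
    have := Submodule.smul_mem (Submodule.span (MvPolynomial ι F) (S : Set A)) (g s)
      (Submodule.subset_span hs)
    rwa [Algebra.smul_def] at this
  have key : ∀ (n : ℕ) (q : Polynomial (MvPolynomial ι F)), q.natDegree = n → q ≠ 0 →
      Polynomial.aeval a q = 0 → ∃ (b : A) (f : MvPolynomial ι F), f ≠ 0 ∧ b * a = Z f := by
    intro n
    induction n using Nat.strong_induction_on with
    | _ n ih =>
      intro q hqn hq hqa
      have hdiv := congrArg (Polynomial.aeval a) (Polynomial.divX_mul_X_add q)
      rw [hqa, map_add, map_mul, Polynomial.aeval_X, Polynomial.aeval_C, hmap] at hdiv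
      by_cases h0 : q.coeff 0 = 0
      · rw [h0, map_zero, add_zero] at hdiv
        have hdiv0 : q.divX ≠ 0 := fun h => hq (by
          rw [← Polynomial.divX_mul_X_add q, h, h0, zero_mul, map_zero, add_zero])
        have hdeg : q.natDegree ≠ 0 := fun h => by
          rw [Polynomial.eq_C_of_natDegree_eq_zero h, h0, map_zero] at hq
          exact hq rfl
        exact ih q.divX.natDegree (by rw [Polynomial.natDegree_divX_eq_natDegree_tsub_one]; omega)
          q.divX rfl hdiv0 ((mul_eq_zero.mp hdiv).resolve_right ha)
      · refine ⟨-Polynomial.aeval a q.divX, q.coeff 0, h0, ?_⟩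
        rw [neg_mul]
        exact neg_eq_of_add_eq_zero_right hdiv
  obtain ⟨q, hq, hqa⟩ := IsIntegral.of_finite (MvPolynomial ι F) a
  exact key _ q rfl hq.ne_zero hqa

theorem IsFiniteOverCentral.exists_ore [NoZeroDivisors A] {Z : MvPolynomial ι F →ₐ[F] A}
    (hZ : IsFiniteOverCentral Z) (r : A) {s : A} (hs : s ≠ 0) :
    ∃ r' s' : A, s' ≠ 0 ∧ s' * r = r' * s := by
  obtain ⟨b, f, hf, h⟩ := hZ.exists_mul_eq hs
  exact ⟨r * b, Z f, (map_ne_zero_iff Z hZ.injective).mpr hf, by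
    rw [hZ.commute, mul_assoc, h]⟩

/-- If the `p`-th powers of the generators are central up to lower order terms, the algebra is
finite over a central polynomial ring. -/
theorem exists_isFiniteOverCentral [Finite ι] {X : ι → A} {Φ : A →ₗ[F] MvPolynomial ι F}
    (hX : IsQuasiPoly F X) (hΦ : IsSymbol X Φ) {p : ℕ} (hp : 0 < p) {z : ι → A}
    (hz : ∀ i a, z i * a = a * z i) (hzX : ∀ i, X i ^ p - z i ∈ filt F X (p - 1)) :
    ∃ Z : MvPolynomial ι F →ₐ[F] A, IsFiniteOverCentral Z := by
  classical
  let Z : MvPolynomial ι F →ₐ[F] A := (Subalgebra.center F A).val.comp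
    (MvPolynomial.aeval fun i => ⟨z i, Subalgebra.mem_center_iff.mpr fun b => (hz i b).symm⟩)
  have hZX : ∀ i, Z (MvPolynomial.X i) = z i := fun i => by simp [Z]
  have hcomm : ∀ f a, Z f * a = a * Z f := fun f a => by
    simp only [Z, AlgHom.comp_apply]
    exact (Subalgebra.mem_center_iff.mp (Subtype.property _) a).symm
  have hXp : ∀ i, X i ^ p ∈ filt F X p ∧
      Φ (X i ^ p) - MvPolynomial.X i ^ p ∈ degLT F ι p := fun i => by
    have := hΦ.pow_symbol (gen_mem_filt i) (by simpa using hΦ [i]) p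
    rwa [mul_one] at this
  have hzs : ∀ i, z i ∈ filt F X p ∧ Φ (z i) - MvPolynomial.X i ^ p ∈ degLT F ι p := fun i => by
    rw [← sub_sub_cancel (X i ^ p) (z i)]
    refine ⟨sub_mem (hXp i).1 (filt_mono (Nat.sub_le _ _) (hzX i)), ?_⟩
    have h1 := hΦ.map_mem_degLT (hzX i)
    rw [Nat.sub_add_cancel hp] at h1
    rw [map_sub, sub_right_comm]
    exact sub_mem (hXp i).2 h1
  have hmon : ∀ ν : ι →₀ ℕ, Z (MvPolynomial.monomial ν 1) ∈ filt F X (p • ν).degree ∧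
      Φ (Z (MvPolynomial.monomial ν 1)) - MvPolynomial.monomial (p • ν) 1 ∈
        degLT F ι (p • ν).degree := by
    intro ν
    induction ν using Finsupp.induction_linear with
    | zero =>
      rw [smul_zero, map_zero, MvPolynomial.monomial_zero', map_one, map_one]
      exact ⟨one_mem_filt 0, hΦ.map_one_sub_mem⟩
    | add μ ν hμ hν =>
      rw [← one_mul (1 : F), ← MvPolynomial.monomial_mul, smul_add, map_add,
        ← MvPolynomial.monomial_mul, map_mul]
      exact ⟨mul_mem_filt hμ.1 hν.1, hΦ.mul_symbol hμ.1 hν.1 hμ.2 hν.2⟩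
    | single i n =>
      have := hΦ.pow_symbol (hzs i).1 (hzs i).2 n
      rw [← pow_mul, ← hZX, ← map_pow, MvPolynomial.X_pow_eq_monomial,
        MvPolynomial.X_pow_eq_monomial] at this
      rw [Finsupp.smul_single, smul_eq_mul, Finsupp.degree_single, mul_comm p n]
      rwa [mul_comm p n] at this
  let dv : (ι →₀ ℕ) → (ι →₀ ℕ) := fun μ => μ.mapRange (· / p) (Nat.zero_div p)
  let md : (ι →₀ ℕ) → (ι →₀ ℕ) := fun μ => μ.mapRange (· % p) (Nat.zero_mod p)
  have hdv : ∀ μ i, dv μ i = μ i / p := fun _ _ => rfl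
  have hmd : ∀ μ i, md μ i = μ i % p := fun _ _ => rfl
  have hdecomp : ∀ μ : ι →₀ ℕ, p • dv μ + md μ = μ := fun μ => by
    ext i
    rw [Finsupp.add_apply, Finsupp.smul_apply, hdv, hmd, smul_eq_mul, Nat.div_add_mod]
  let y : (ι →₀ ℕ) → A := fun μ => Z (MvPolynomial.monomial (dv μ) 1) * orderedMonomial X (md μ)
  have hy : ∀ μ, Φ (y μ) - MvPolynomial.monomial μ 1 ∈ degLT F ι μ.degree := fun μ => by
    have := hΦ.mul_symbol (hmon (dv μ)).1 (orderedMonomial_mem_filt (md μ)) (hmon _).2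
      (hΦ.orderedMonomial_symbol (md μ))
    rwa [MvPolynomial.monomial_mul, ← map_add, hdecomp, one_mul] at this
  refine ⟨Z, ?_, hcomm, ?_⟩
  · have hli : LinearIndependent F fun ν : ι →₀ ℕ => Φ (y (p • ν)) :=
      (linearIndependent_of_symbol hy).comp (fun ν : ι →₀ ℕ => p • ν)
        (fun a b h => by
          ext i
          have := DFunLike.congr_fun h i
          simpa [hp.ne'] using this)
    have hy' : ∀ ν : ι →₀ ℕ, y (p • ν) = Z (MvPolynomial.monomial ν 1) := fun ν => by
      have h1 : dv (p • ν) = ν := by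
        ext i
        rw [hdv, Finsupp.smul_apply, smul_eq_mul, Nat.mul_div_cancel_left _ hp]
      have h2 : md (p • ν) = 0 := by
        ext i
        rw [hmd, Finsupp.smul_apply, smul_eq_mul, Nat.mul_mod_right, Finsupp.zero_apply]
      simp only [y, h1, h2]
      simp [orderedMonomial]
    simp only [hy'] at hli
    rw [injective_iff_map_eq_zero]
    intro f hf
    rw [linearIndependent_iff'] at hli
    have hsum : ∑ ν ∈ f.support, f.coeff ν • Φ (Z (MvPolynomial.monomial ν 1)) = 0 := by
      simp only [← map_smul, ← map_sum, smul_eq_mul, mul_one]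
      rw [← f.as_sum, hf, map_zero]
    ext ν
    by_cases hν : ν ∈ f.support
    · exact hli _ _ hsum ν hν
    · simpa using hν
  · let e : (ι → Fin p) → ι →₀ ℕ := fun g => Finsupp.equivFunOnFinite.symm fun i => (g i : ℕ)
    have := Fintype.ofFinite ι
    refine ⟨Finset.univ.image fun g : ι → Fin p => orderedMonomial X (e g), fun a => ?_⟩
    have ha : a ∈ Submodule.span F (Set.range y) := hΦ.span_eq_top hX hy ▸ Submodule.mem_top
    induction ha using Submodule.span_induction with
    | mem x hx =>
      obtain ⟨μ, rfl⟩ := hx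
      refine ⟨Pi.single (orderedMonomial X (md μ)) (MvPolynomial.monomial (dv μ) 1), ?_⟩
      rw [Finset.sum_eq_single (orderedMonomial X (md μ))]
      · rw [Pi.single_eq_same]
      · intro s _ hs
        rw [Pi.single_eq_of_ne hs, map_zero, zero_mul]
      · intro h
        refine absurd (Finset.mem_image.mpr ⟨fun i => ⟨μ i % p, Nat.mod_lt _ hp⟩,
          Finset.mem_univ _, ?_⟩) h
        congr 1
        ext i
        rfl
    | zero => exact ⟨0, by simp⟩
    | add x y _ _ hx hy =>
      obtain ⟨g, hg⟩ := hx
      obtain ⟨g', hg'⟩ := hy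
      exact ⟨g + g', by
        conv_lhs => rw [hg, hg']
        simp [add_mul, Finset.sum_add_distrib]⟩
    | smul c x _ hx =>
      obtain ⟨g, hg⟩ := hx
      exact ⟨c • g, by
        conv_lhs => rw [hg]
        simp [Finset.smul_sum]⟩

end central

universe u

/-- The image of `α : A → Q` generates, as a division ring, all the elements `x l`. -/
def GeneratesFractions {F A Q ι : Type*} [Field F] [Ring A] [Algebra F A] [DivisionRing Q]
    [Algebra F Q] (α : A →ₐ[F] Q) (x : ι → Q) : Prop :=
  ∀ l, ∃ τ w, α τ ≠ 0 ∧ α τ * x l = α w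

section transcendence

variable {F A Q ι : Type*} [Field F] [Ring A] [Algebra F A] [DivisionRing Q] [Algebra F Q]

theorem Subalgebra.inv_mem_of_finite (M : Subalgebra F Q) [Module.Finite F M] {x : Q}
    (hx : x ∈ M) : x⁻¹ ∈ M := by
  rcases eq_or_ne x 0 with rfl | h0
  · simp
  · obtain ⟨y, hy⟩ := FiniteDimensional.exists_mul_eq_one F (K := M) (x := ⟨x, hx⟩)
      (fun h => h0 (congrArg Subtype.val h))
    rw [inv_eq_of_mul_eq_one_right (congrArg Subtype.val hy)]
    exact y.2

theorem GeneratesFractions.mem {A' : Type*} [Ring A'] [Algebra F A'] {X : ι → A'}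
    (hX : Algebra.adjoin F (Set.range X) = ⊤) {f : A' →ₐ[F] Q} (hf : Function.Injective f)
    (hfrac : ∀ d, ∃ a b, b ≠ 0 ∧ f b * d = f a) {α : A →ₐ[F] Q}
    (hα : GeneratesFractions α fun l => f (X l)) {S : Subalgebra F Q}
    (hS : ∀ x ∈ S, x⁻¹ ∈ S) (hαS : ∀ a, α a ∈ S) (d : Q) : d ∈ S := by
  have key : ∀ {b d a : Q}, b ≠ 0 → b * d = a → b ∈ S → a ∈ S → d ∈ S := by
    rintro b d _ h0 rfl hb ha
    simpa [h0] using S.mul_mem (hS b hb) ha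
  have hfS : ∀ a, f a ∈ S := by
    have : Algebra.adjoin F (Set.range X) ≤ S.comap f := by
      rw [Algebra.adjoin_le_iff]
      rintro _ ⟨l, rfl⟩
      obtain ⟨τ, w, h0, h⟩ := hα l
      exact key h0 h (hαS τ) (hαS w)
    rw [hX] at this
    exact fun a => this Algebra.mem_top
  obtain ⟨a, b, hb, h⟩ := hfrac d
  exact key ((map_ne_zero_iff f hf).mpr hb) h (hfS b) (hfS a)

theorem isAlgebraic_of_finite {L C : Type*} [Field L] [Field C] [Algebra F L] [Algebra L C]
    [Algebra C Q] [Algebra L Q] [IsScalarTower L C Q] [IsScalarTower F L Q]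
    {Z : MvPolynomial ι F →ₐ[F] A}
    (hZ : ∃ S : Finset A, ∀ a, ∃ g : A → MvPolynomial ι F, a = ∑ s ∈ S, Z (g s) * s)
    {α : A →ₐ[F] Q} {z : MvPolynomial ι F → L} (hz : ∀ f, algebraMap L Q (z f) = α (Z f))
    (hα : ∀ S : Subalgebra F Q, (∀ x ∈ S, x⁻¹ ∈ S) → (∀ a, α a ∈ S) → ∀ d, d ∈ S) :
    Algebra.IsAlgebraic L C := by
  classical
  let M : Subalgebra L Q := Algebra.adjoin L (Set.range α)
  obtain ⟨S, hS⟩ := hZ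
  have hspan : Subalgebra.toSubmodule M = Submodule.span L (α '' S) := by
    rw [Algebra.adjoin_eq_span]
    apply le_antisymm
    · rw [Submodule.span_le]
      have : (Submonoid.closure (Set.range α) : Set Q) = Set.range α :=
        congrArg SetLike.coe (Submonoid.closure_eq (MonoidHom.mrange (α : A →* Q)))
      rw [this]
      rintro _ ⟨a, rfl⟩
      obtain ⟨g, hg⟩ := hS a
      rw [hg, map_sum]
      refine sum_mem fun s hs => ?_
      have := Submodule.smul_mem (Submodule.span L (α '' S)) (z (g s))
        (Submodule.subset_span ⟨s, hs, rfl⟩)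
      rwa [Algebra.smul_def, hz, ← map_mul] at this
    · exact Submodule.span_mono ((Set.image_subset_range _ _).trans Submonoid.subset_closure)
  have hMfin : Module.Finite L M := by
    have : Module.Finite L (Subalgebra.toSubmodule M) := by
      rw [hspan]
      exact Module.Finite.span_of_finite L ((Finset.finite_toSet S).image _)
    exact this
  have hαM : ∀ a, α a ∈ M := fun a => Algebra.subset_adjoin (Set.mem_range_self a)
  have hMtop : ∀ d, d ∈ M :=
    hα (M.restrictScalars F) (fun x hx => M.inv_mem_of_finite hx) hαM
  refine ⟨fun c => ?_⟩
  have h1 : IsIntegral L (⟨algebraMap C Q c, hMtop _⟩ : M) := IsIntegral.of_finite L _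
  have h2 : IsIntegral L (algebraMap C Q c) := h1.map M.val
  exact (isAlgebraic_algebraMap_iff (algebraMap C Q).injective).mp h2.isAlgebraic

theorem isAlgebraic_adjoin_of_finite {C : Type*} [Field C] [Algebra F C] [Algebra C Q]
    [IsScalarTower F C Q] {Z : MvPolynomial ι F →ₐ[F] A}
    (hZ : ∃ S : Finset A, ∀ a, ∃ g : A → MvPolynomial ι F, a = ∑ s ∈ S, Z (g s) * s)
    {α : A →ₐ[F] Q} {z : MvPolynomial ι F →ₐ[F] C} (hz : ∀ f, algebraMap C Q (z f) = α (Z f))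
    (hα : ∀ S : Subalgebra F Q, (∀ x ∈ S, x⁻¹ ∈ S) → (∀ a, α a ∈ S) → ∀ d, d ∈ S) :
    Algebra.IsAlgebraic (Algebra.adjoin F (Set.range fun i => z (MvPolynomial.X i))) C := by
  set T : Set C := Set.range fun i => z (MvPolynomial.X i)
  let L := IntermediateField.adjoin F T
  have hzL : ∀ f, z f ∈ L := by
    intro f
    have h1 : z f ∈ Algebra.adjoin F T := by
      rw [Algebra.adjoin_range_eq_range_aeval]
      exact ⟨f, (DFunLike.congr_fun (MvPolynomial.aeval_unique z) f).symm⟩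
    exact IntermediateField.algebra_adjoin_le_adjoin _ _ h1
  have hCL : Algebra.IsAlgebraic L C :=
    isAlgebraic_of_finite hZ (z := fun f => ⟨z f, hzL f⟩) hz hα
  open scoped IntermediateField.algebraAdjoinAdjoin in
  exact (IsFractionRing.comap_isAlgebraic_iff (A := Algebra.adjoin F T) (K := L)).mpr hCL

/-- If `A'` has at least as many generators as `A`, no nonzero element of `A` maps to zero under a
homomorphism to the fractions of `A'` whose image generates these fractions. -/
theorem GeneratesFractions.injective {F A A' : Type*} {Q ι ι' : Type u} [Field F] [Ring A]
    [NoZeroDivisors A] [Algebra F A] [Ring A'] [Algebra F A'] [DivisionRing Q] [Algebra F Q]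
    [Finite ι] {Z : MvPolynomial ι F →ₐ[F] A} (hZ : IsFiniteOverCentral Z)
    {Z' : MvPolynomial ι' F →ₐ[F] A'} (hZ' : IsFiniteOverCentral Z')
    {X : ι' → A'} (hX : Algebra.adjoin F (Set.range X) = ⊤)
    {f : A' →ₐ[F] Q} (hf : Function.Injective f) (hfrac : ∀ d, ∃ a b, b ≠ 0 ∧ f b * d = f a)
    {α : A →ₐ[F] Q} (hα : GeneratesFractions α fun l => f (X l)) :
    Cardinal.mk ι' ≤ Cardinal.mk ι ∧
      (Cardinal.mk ι ≤ Cardinal.mk ι' → Function.Injective α) := by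
  have hS := fun {S : Subalgebra F Q} => hα.mem hX hf hfrac (S := S)
  have hcent : ∀ c x : Q, x ∈ Subalgebra.centralizer F {c} →
      x⁻¹ ∈ Subalgebra.centralizer F {c} := by
    intro c x hx
    rw [Subalgebra.mem_centralizer_iff] at hx ⊢
    intro g hg
    exact (Commute.inv_right₀ (hx g hg) : Commute g x⁻¹)
  have hcomm : ∀ g d, d * α (Z g) = α (Z g) * d := fun g d => by
    have := hS (hcent (α (Z g))) (fun a => by
      rw [Subalgebra.mem_centralizer_iff]
      rintro _ rfl
      rw [← map_mul, ← map_mul, hZ.commute]) d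
    exact ((Subalgebra.mem_centralizer_iff F).mp this _ rfl).symm
  have hf' : GeneratesFractions f fun l => f (X l) := fun l => ⟨1, X l, by simp, by simp⟩
  have hcomm' : ∀ g d, d * f (Z' g) = f (Z' g) * d := fun g d => by
    have := hf'.mem hX hf hfrac (hcent (f (Z' g))) (fun a => by
      rw [Subalgebra.mem_centralizer_iff]
      rintro _ rfl
      rw [← map_mul, ← map_mul, hZ'.commute]) d
    exact ((Subalgebra.mem_centralizer_iff F).mp this _ rfl).symm
  let C := Subring.center Q
  let _ : Algebra F C := ((algebraMap F Q).codRestrict C fun c =>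
    Subring.mem_center_iff.mpr fun d => (Algebra.commutes c d).symm).toAlgebra
  have : IsScalarTower F C Q := IsScalarTower.of_algebraMap_eq' rfl
  let z : MvPolynomial ι F →ₐ[F] C :=
    { (α.comp Z).toRingHom.codRestrict C fun g => Subring.mem_center_iff.mpr (hcomm g) with
      commutes' := fun c => Subtype.ext ((α.comp Z).commutes c) }
  let z' : MvPolynomial ι' F →ₐ[F] C :=
    { (f.comp Z').toRingHom.codRestrict C fun g => Subring.mem_center_iff.mpr (hcomm' g) with
      commutes' := fun c => Subtype.ext ((f.comp Z').commutes c) }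
  have halg := isAlgebraic_adjoin_of_finite hZ.finite (z := z) (fun _ => rfl) fun S => hS
  have hind : AlgebraicIndependent F fun l => z' (MvPolynomial.X l) := by
    have h1 := MvPolynomial.aeval_unique z'
    rw [algebraicIndependent_iff_injective_aeval]
    change Function.Injective (MvPolynomial.aeval (z' ∘ MvPolynomial.X))
    rw [← h1]
    exact fun a b h => hZ'.injective (hf (congrArg Subtype.val h))
  have hle := hind.cardinalMk_le_trdeg
  have hle' := Algebra.IsAlgebraic.trdeg_le_cardinalMk F
    (Set.range fun i => z (MvPolynomial.X i))
  refine ⟨hle.trans (hle'.trans Cardinal.mk_range_le), fun h => ?_⟩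
  have hbasis := Algebra.IsAlgebraic.isTranscendenceBasis_of_le_trdeg_of_finite F
    (fun i => z (MvPolynomial.X i)) (h.trans hle)
  have hzinj : Function.Injective z := by
    have h1 := MvPolynomial.aeval_unique z
    rw [h1]
    exact algebraicIndependent_iff_injective_aeval.mp hbasis.1
  rw [injective_iff_map_eq_zero]
  intro a ha
  by_contra h0
  obtain ⟨b, g, hg, h⟩ := hZ.exists_mul_eq h0
  refine hg (hzinj ?_)
  rw [map_zero]
  exact Subtype.ext (show α (Z g) = 0 by rw [← h, map_mul, ha, mul_zero])

end transcendence

section fractions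

variable {F A Q : Type*} [Field F] [Ring A] [NoZeroDivisors A] [Nontrivial A] [Algebra F A]

theorem exists_mul_eq_of_injective [DivisionRing Q] [Algebra F Q]
    (hA : ∀ r s : A, s ≠ 0 → ∃ r' s', s' ≠ 0 ∧ s' * r = r' * s) {α : A →ₐ[F] Q}
    (hinj : Function.Injective α)
    (hα : ∀ S : Subalgebra F Q, (∀ x ∈ S, x⁻¹ ∈ S) → (∀ a, α a ∈ S) → ∀ d, d ∈ S) (d : Q) :
    ∃ a b, b ≠ 0 ∧ α b * d = α a := by
  let S : Subalgebra F Q :=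
    { carrier := {d | ∃ a b, b ≠ 0 ∧ α b * d = α a}
      mul_mem' := by
        rintro d₁ d₂ ⟨a₁, b₁, h₁, e₁⟩ ⟨a₂, b₂, h₂, e₂⟩
        obtain ⟨r, s, hs, h⟩ := hA a₁ b₂ h₂
        refine ⟨r * a₂, s * b₁, mul_ne_zero hs h₁, ?_⟩
        rw [map_mul, map_mul, mul_assoc, ← mul_assoc (α b₁), e₁, ← mul_assoc, ← map_mul, h, map_mul,
          mul_assoc, e₂]
      add_mem' := by
        rintro d₁ d₂ ⟨a₁, b₁, h₁, e₁⟩ ⟨a₂, b₂, h₂, e₂⟩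
        obtain ⟨r, s, hs, h⟩ := hA b₁ b₂ h₂
        refine ⟨s * a₁ + r * a₂, s * b₁, mul_ne_zero hs h₁, ?_⟩
        rw [mul_add, map_add]
        congr 1
        · rw [map_mul, mul_assoc, e₁, map_mul]
        · rw [h, map_mul, mul_assoc, e₂, map_mul]
      algebraMap_mem' := fun c => ⟨algebraMap F A c, 1, one_ne_zero, by simp⟩ }
  refine hα S ?_ (fun a => ⟨a, 1, one_ne_zero, by simp⟩) d
  rintro x ⟨a, b, hb, h⟩
  rcases eq_or_ne x 0 with rfl | hx
  · exact ⟨0, 1, one_ne_zero, by simp⟩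
  · refine ⟨b, a, ?_, ?_⟩
    · rintro rfl
      rw [map_zero] at h
      exact mul_ne_zero ((map_ne_zero_iff α hinj).mpr hb) hx h
    · rw [← h, mul_assoc, mul_inv_cancel₀ hx, mul_one]

open OreLocalization nonZeroDivisors in
theorem exists_divisionRing_of_ore {A : Type u} [Ring A] [NoZeroDivisors A] [Nontrivial A]
    [Algebra F A] (hA : ∀ r s : A, s ≠ 0 → ∃ r' s', s' ≠ 0 ∧ s' * r = r' * s) :
    ∃ (Q : Type u) (_ : DivisionRing Q) (_ : Algebra F Q) (f : A →ₐ[F] Q),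
      Function.Injective f ∧ ∀ d, ∃ a b, b ≠ 0 ∧ f b * d = f a := by
  obtain ⟨_⟩ : Nonempty (OreSet A⁰) := nonempty_oreSet_iff_of_noZeroDivisors.mpr fun r s => by
    obtain ⟨r', s', hs, h⟩ := hA r s (nonZeroDivisors.coe_ne_zero s)
    exact ⟨r', ⟨s', mem_nonZeroDivisors_of_ne_zero hs⟩, h⟩
  let f : A →ₐ[F] A[A⁰⁻¹] := { numeratorRingHom with commutes' := fun c => rfl }
  refine ⟨A[A⁰⁻¹], inferInstance, inferInstance, f, numeratorHom_inj inf_le_left, fun d => ?_⟩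
  induction d using OreLocalization.ind with
  | _ a b =>
    refine ⟨a, b, nonZeroDivisors.coe_ne_zero b, ?_⟩
    exact OreLocalization.mul_cancel

open OreLocalization nonZeroDivisors in
theorem exists_oreLocalization_lift {A B : Type*} [Ring A] [Nontrivial A] [OreSet A⁰] [Ring B]
    {g : A →+* B} (hg : ∀ a, a ≠ 0 → IsUnit (g a)) :
    ∃ φ : A[A⁰⁻¹] →+* B, ∀ a, φ (numeratorHom a) = g a := by
  let u : A⁰ → Bˣ := fun s => (hg s (nonZeroDivisors.coe_ne_zero s)).unit
  have hu : ∀ s, (u s : B) = g s := fun s => IsUnit.unit_spec _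
  exact ⟨universalHom g
    { toFun := u
      map_one' := Units.ext (by rw [hu]; simp)
      map_mul' := fun s t => Units.ext (by rw [Units.val_mul, hu, hu, hu]; simp) }
    fun s => (hu s).symm, fun a => universalHom_commutes _ _ _⟩

open OreLocalization nonZeroDivisors in
theorem exists_extension_of_fractions [DivisionRing Q] [Algebra F Q] {f : A →ₐ[F] Q}
    (hf : Function.Injective f) (hfrac : ∀ d, ∃ a b, b ≠ 0 ∧ f b * d = f a) {B : Type*} [Ring B]
    {g : A →+* B} (hg : ∀ a, a ≠ 0 → IsUnit (g a)) : ∃ Ψ : Q →+* B, ∀ a, Ψ (f a) = g a := by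
  have hf0 : ∀ s, s ≠ 0 → f s ≠ 0 := fun s hs => (map_ne_zero_iff f hf).mpr hs
  obtain ⟨_⟩ : Nonempty (OreSet A⁰) := nonempty_oreSet_iff_of_noZeroDivisors.mpr fun r s => by
    obtain ⟨a, b, hb, h⟩ := hfrac (f r * (f s)⁻¹)
    refine ⟨a, ⟨b, mem_nonZeroDivisors_of_ne_zero hb⟩, hf ?_⟩
    rw [map_mul, map_mul, ← h, mul_assoc, mul_assoc,
      inv_mul_cancel₀ (hf0 _ (nonZeroDivisors.coe_ne_zero s)), mul_one]
  obtain ⟨φ, hφ⟩ := exists_oreLocalization_lift (g := (f : A →+* Q))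
    fun a ha => (hf0 a ha).isUnit
  obtain ⟨ψ, hψ⟩ := exists_oreLocalization_lift hg
  have hsurj : Function.Surjective φ := fun d => by
    obtain ⟨a, b, hb, h⟩ := hfrac d
    refine ⟨(numeratorHom b)⁻¹ * numeratorHom a, ?_⟩
    rw [map_mul, map_inv₀, hφ, hφ]
    change (f b)⁻¹ * f a = d
    rw [← h, inv_mul_cancel_left₀ (hf0 b hb)]
  let e := RingEquiv.ofBijective φ ⟨φ.injective, hsurj⟩
  refine ⟨ψ.comp e.symm.toRingHom, fun a => ?_⟩
  have : e.symm (f a) = numeratorHom a := e.symm_apply_eq.mpr (hφ a).symm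
  change ψ (e.symm (f a)) = g a
  rw [this, hψ]

end fractions

section presentation

/-- The elements `Y i` satisfy the affine commutation relations with structure constants `c` and
`ω`. -/
def SatisfiesRel {ι B : Type*} [Fintype ι] [Ring B] (c : ι → ι → ι → ℤ) (ω : ι → ι → ℤ)
    (Y : ι → B) : Prop :=
  ∀ i j, Y i * Y j - Y j * Y i = ∑ l, (c i j l : B) * Y l + (ω i j : B)

/-- `A` is the algebra presented by the generators `X` and the relations `SatisfiesRel c ω`. -/
structure IsPresented (F : Type*) {ι : Type*} {A : Type u} [Fintype ι] [Field F] [Ring A]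
    [Algebra F A] (c : ι → ι → ι → ℤ) (ω : ι → ι → ℤ) (X : ι → A) : Prop where
  rel : SatisfiesRel c ω X
  adjoin_eq_top : Algebra.adjoin F (Set.range X) = ⊤
  lift : ∀ (B : Type u) [Ring B] [Algebra F B] (Y : ι → B), SatisfiesRel c ω Y →
    ∃ g : A →ₐ[F] B, ∀ i, g (X i) = Y i

variable {ι : Type*} [Fintype ι] {c : ι → ι → ι → ℤ} {ω : ι → ι → ℤ}

theorem SatisfiesRel.map {B B' : Type*} [Ring B] [Ring B'] {Y : ι → B} (hY : SatisfiesRel c ω Y)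
    (g : B →+* B') : SatisfiesRel c ω fun i => g (Y i) := fun i j => by
  rw [← map_mul, ← map_mul, ← map_sub, hY i j]
  simp only [map_add, map_sum, map_mul, map_intCast]

theorem IsPresented.isQuasiPoly {F A : Type*} [Field F] [Ring A] [Algebra F A] {X : ι → A}
    (h : IsPresented F c ω X) : IsQuasiPoly F X where
  adjoin_eq_top := h.adjoin_eq_top
  commutator_mem i j := by
    rw [h.rel i j]
    refine add_mem (sum_mem fun l _ => ?_) ?_
    · rw [← zsmul_eq_mul]
      exact zsmul_mem (gen_mem_filt l) _
    · rw [← zsmul_one]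
      exact zsmul_mem (one_mem_filt 1) _

end presentation

section limit

variable {J : Type u} (𝓕 : Filter J) (Q : J → Type u) [∀ j, DivisionRing (Q j)]

/-- Eventual equality of families of elements of the division rings `Q j`. -/
def eventuallyEqCon : RingCon (∀ j, Q j) where
  r x y := ∀ᶠ j in 𝓕, x j = y j
  iseqv := ⟨fun _ => .of_forall fun _ => rfl, fun h => h.mono fun _ => Eq.symm,
    fun h h' => h.mp (h'.mono fun _ h' h => h.trans h')⟩
  mul' h h' := h.mp (h'.mono fun _ h' h => congrArg₂ _ h h')
  add' h h' := h.mp (h'.mono fun _ h' h => congrArg₂ _ h h')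

variable {𝓕 Q}

theorem eventuallyEqCon_mk_eq {x y : ∀ j, Q j} :
    (eventuallyEqCon 𝓕 Q).mk' x = (eventuallyEqCon 𝓕 Q).mk' y ↔ ∀ᶠ j in 𝓕, x j = y j :=
  (eventuallyEqCon 𝓕 Q).eq

theorem eventuallyEqCon_isUnit_iff {x : ∀ j, Q j} :
    IsUnit ((eventuallyEqCon 𝓕 Q).mk' x) ↔ ∀ᶠ j in 𝓕, x j ≠ 0 := by
  constructor
  · intro h
    obtain ⟨y, hy⟩ := h.exists_right_inv
    obtain ⟨y, rfl⟩ := RingCon.mk'_surjective _ y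
    rw [← map_mul, ← map_one (eventuallyEqCon 𝓕 Q).mk', eventuallyEqCon_mk_eq] at hy
    exact hy.mono fun j h => left_ne_zero_of_mul_eq_one h
  · intro h
    refine isUnit_iff_exists.mpr ⟨(eventuallyEqCon 𝓕 Q).mk' x⁻¹, ?_, ?_⟩
    all_goals
      rw [← map_mul, ← map_one (eventuallyEqCon 𝓕 Q).mk', eventuallyEqCon_mk_eq]
    · exact h.mono fun j h => mul_inv_cancel₀ h
    · exact h.mono fun j h => inv_mul_cancel₀ h

/-- A family of maps between fields that eventually respects each sum and each product. -/
structure IsEventualHom {K : Type*} [Field K] (𝓕 : Filter J) {k : J → Type*} [∀ j, Field (k j)]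
    (θ : ∀ j, K → k j) : Prop where
  zero : ∀ᶠ j in 𝓕, θ j 0 = 0
  one : ∀ᶠ j in 𝓕, θ j 1 = 1
  add : ∀ x y, ∀ᶠ j in 𝓕, θ j (x + y) = θ j x + θ j y
  mul : ∀ x y, ∀ᶠ j in 𝓕, θ j (x * y) = θ j x * θ j y

variable {K : Type*} [Field K] {k : J → Type*} [∀ j, Field (k j)] {θ : ∀ j, K → k j}

theorem IsEventualHom.ne_zero (hθ : IsEventualHom 𝓕 θ) {x : K} (hx : x ≠ 0) :
    ∀ᶠ j in 𝓕, θ j x ≠ 0 := by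
  filter_upwards [hθ.one, hθ.mul x x⁻¹] with j h1 h2
  rw [mul_inv_cancel₀ hx, h1] at h2
  exact left_ne_zero_of_mul_eq_one h2.symm

variable [∀ j, Algebra (k j) (Q j)]

/-- The ring homomorphism from `K` to the limit of the `Q j` induced by `θ`. -/
def IsEventualHom.toLimit (hθ : IsEventualHom 𝓕 θ) : K →+* (eventuallyEqCon 𝓕 Q).Quotient where
  toFun x := (eventuallyEqCon 𝓕 Q).mk' fun j => algebraMap (k j) (Q j) (θ j x)
  map_zero' := by
    rw [← map_zero (eventuallyEqCon 𝓕 Q).mk', eventuallyEqCon_mk_eq]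
    exact hθ.zero.mono fun j h => by rw [h, map_zero]; rfl
  map_one' := by
    rw [← map_one (eventuallyEqCon 𝓕 Q).mk', eventuallyEqCon_mk_eq]
    exact hθ.one.mono fun j h => by rw [h, map_one]; rfl
  map_add' x y := by
    rw [← map_add (eventuallyEqCon 𝓕 Q).mk', eventuallyEqCon_mk_eq]
    exact (hθ.add x y).mono fun j h => by rw [h, map_add]; rfl
  map_mul' x y := by
    rw [← map_mul (eventuallyEqCon 𝓕 Q).mk', eventuallyEqCon_mk_eq]
    exact (hθ.mul x y).mono fun j h => by rw [h, map_mul]; rfl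

theorem IsEventualHom.toLimit_commutes (hθ : IsEventualHom 𝓕 θ) (x : K)
    (q : (eventuallyEqCon 𝓕 Q).Quotient) : hθ.toLimit x * q = q * hθ.toLimit x := by
  obtain ⟨q, rfl⟩ := RingCon.mk'_surjective _ q
  change (eventuallyEqCon 𝓕 Q).mk' _ * _ = _ * (eventuallyEqCon 𝓕 Q).mk' _
  rw [← map_mul, ← map_mul]
  congr 1
  funext j
  exact Algebra.commutes _ _

theorem eventually_exists_generatesFractions (hθ : IsEventualHom 𝓕 θ)
    {ι ι' : Type*} [Fintype ι] [Fintype ι'] {c : ι → ι → ι → ℤ} {ω : ι → ι → ℤ}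
    {c' : ι' → ι' → ι' → ℤ} {ω' : ι' → ι' → ℤ} {A A' : Type u} {D : Type*} [Ring A] [Algebra K A]
    [Ring A'] [Algebra K A'] [NoZeroDivisors A'] [Nontrivial A'] [DivisionRing D] [Algebra K D]
    {X : ι → A} (hX : IsPresented K c ω X) {X' : ι' → A'} (hX' : IsPresented K c' ω' X')
    {f : A →ₐ[K] D} (hf : Function.Injective f) (hfrac : ∀ d, ∃ a b, b ≠ 0 ∧ f b * d = f a)
    {f' : A' →ₐ[K] D} (hf' : Function.Injective f')
    (hfrac' : ∀ d, ∃ a b, b ≠ 0 ∧ f' b * d = f' a)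
    {Aj : J → Type u} {Aj' : J → Type*} [∀ j, Ring (Aj j)] [∀ j, Algebra (k j) (Aj j)]
    [∀ j, Ring (Aj' j)] [∀ j, Algebra (k j) (Aj' j)]
    {Xj : ∀ j, ι → Aj j} (hXj : ∀ j, IsPresented (k j) c ω (Xj j))
    {Xj' : ∀ j, ι' → Aj' j} (hXj' : ∀ j, SatisfiesRel c' ω' (Xj' j))
    (hli : ∀ j, LinearIndependent (k j) (orderedMonomial (Xj' j)))
    {fj : ∀ j, Aj' j →ₐ[k j] Q j} (hfj : ∀ j, Function.Injective (fj j)) :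
    ∀ᶠ j in 𝓕, ∃ α : Aj j →ₐ[k j] Q j, GeneratesFractions α fun l => fj j (Xj' j l) := by
  let mk := (eventuallyEqCon 𝓕 Q).mk'
  let _ : Algebra K (eventuallyEqCon 𝓕 Q).Quotient := hθ.toLimit.toAlgebra' hθ.toLimit_commutes
  have hmk : ∀ x, algebraMap K (eventuallyEqCon 𝓕 Q).Quotient x =
    mk fun j => algebraMap (k j) (Q j) (θ j x) := fun _ => rfl
  have hrel' : SatisfiesRel c' ω' fun l j => fj j (Xj' j l) := fun a b => by
    funext j
    have := (hXj' j).map (fj j : Aj' j →+* Q j) a b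
    simpa using this
  obtain ⟨g', hg'⟩ := hX'.lift _ _ (hrel'.map mk)
  have hunit : ∀ a, a ≠ 0 → IsUnit ((g' : A' →+* (eventuallyEqCon 𝓕 Q).Quotient) a) := by
    intro a ha
    have hspan : a ∈ Submodule.span K (Set.range (orderedMonomial X')) :=
      hX'.isQuasiPoly.span_orderedMonomial ▸ Submodule.mem_top
    obtain ⟨d, rfl⟩ := Finsupp.mem_span_range_iff_exists_finsupp.mp hspan
    have hmon : ∀ μ, g' (orderedMonomial X' μ) =
        mk fun j => fj j (orderedMonomial (Xj' j) μ) := fun μ => by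
      have h1 : (fun j => fj j (orderedMonomial (Xj' j) μ)) =
          orderedMonomial (fun l j => fj j (Xj' j l)) μ := by
        funext j
        exact (map_orderedMonomial (fj j : Aj' j →+* Q j) _ _).trans
          (map_orderedMonomial (Pi.evalRingHom Q j) (fun l j => fj j (Xj' j l)) μ).symm
      rw [h1, map_orderedMonomial, ← RingHom.coe_coe g', map_orderedMonomial]
      exact congrArg (orderedMonomial · μ) (funext hg')
    have hval : g' (d.sum fun μ r => r • orderedMonomial X' μ) =
        mk fun j => fj j (∑ μ ∈ d.support, θ j (d μ) • orderedMonomial (Xj' j) μ) := by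
      have h1 : (fun j => fj j (∑ μ ∈ d.support, θ j (d μ) • orderedMonomial (Xj' j) μ)) =
          ∑ μ ∈ d.support, (fun j => algebraMap (k j) (Q j) (θ j (d μ))) *
            fun j => fj j (orderedMonomial (Xj' j) μ) := by
        funext j
        rw [map_sum, Finset.sum_apply]
        simp [Algebra.smul_def]
      rw [h1, map_sum, Finsupp.sum, map_sum]
      refine Finset.sum_congr rfl fun μ _ => ?_
      rw [map_smul, Algebra.smul_def, hmon, hmk, map_mul]
    rw [RingHom.coe_coe, hval, eventuallyEqCon_isUnit_iff]
    obtain ⟨ν, hν⟩ : ∃ ν, d ν ≠ 0 := by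
      by_contra! h
      exact ha (by simp [Finsupp.sum, h])
    filter_upwards [hθ.ne_zero hν] with j hj h
    refine hj (linearIndependent_iff'.mp (hli j) d.support (fun μ => θ j (d μ)) ?_ ν
      (Finsupp.mem_support_iff.mpr hν))
    exact (map_eq_zero_iff _ (hfj j)).mp h
  obtain ⟨Ψ, hΨ⟩ := exists_extension_of_fractions hf' hfrac' hunit
  have hΨK : ∀ x, Ψ (algebraMap K D x) = mk fun j => algebraMap (k j) (Q j) (θ j x) := fun x => by
    rw [← hmk, ← f'.commutes, hΨ]
    exact g'.commutes x
  choose ξ hξ using fun i => RingCon.mk'_surjective _ (Ψ (f (X i)))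
  have hrel : ∀ᶠ j in 𝓕, SatisfiesRel c ω fun i => ξ i j := by
    simp only [SatisfiesRel, Filter.eventually_all]
    intro a b
    have := hX.rel.map (Ψ.comp (f : A →+* D)) a b
    simp only [RingHom.comp_apply, RingHom.coe_coe, ← hξ] at this
    have h1 : mk (ξ a * ξ b - ξ b * ξ a) =
        mk (∑ l, (c a b l : ∀ j, Q j) * ξ l + (ω a b : ∀ j, Q j)) := by
      simp only [map_sub, map_mul, map_add, map_sum, map_intCast]
      exact this
    exact (eventuallyEqCon_mk_eq.mp h1).mono fun j hj => by simpa using hj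
  have hadj : ∀ a : A, ∃ η : ∀ j, Q j, mk η = Ψ (f a) ∧
      ∀ᶠ j in 𝓕, η j ∈ Algebra.adjoin (k j) (Set.range fun i => ξ i j) := by
    intro a
    have ha : a ∈ Algebra.adjoin K (Set.range X) := hX.adjoin_eq_top ▸ Algebra.mem_top
    induction ha using Algebra.adjoin_induction with
    | mem x hx =>
      obtain ⟨i, rfl⟩ := hx
      exact ⟨ξ i, hξ i, .of_forall fun j => Algebra.subset_adjoin ⟨i, rfl⟩⟩
    | algebraMap r =>
      refine ⟨_, ?_, .of_forall fun j => Subalgebra.algebraMap_mem _ (θ j r)⟩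
      rw [f.commutes, hΨK]
    | add x y _ _ hx hy =>
      obtain ⟨η, h1, h2⟩ := hx
      obtain ⟨η', h1', h2'⟩ := hy
      refine ⟨η + η', by rw [map_add, map_add, map_add, h1, h1'], ?_⟩
      filter_upwards [h2, h2'] with j h h'
      exact add_mem h h'
    | mul x y _ _ hx hy =>
      obtain ⟨η, h1, h2⟩ := hx
      obtain ⟨η', h1', h2'⟩ := hy
      refine ⟨η * η', by rw [map_mul, map_mul, map_mul, h1, h1'], ?_⟩
      filter_upwards [h2, h2'] with j h h'
      exact mul_mem h h'
  have hgen : ∀ᶠ j in 𝓕, ∀ l, ∃ τ ∈ Algebra.adjoin (k j) (Set.range fun i => ξ i j),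
      ∃ w ∈ Algebra.adjoin (k j) (Set.range fun i => ξ i j), τ ≠ 0 ∧
        τ * fj j (Xj' j l) = w := by
    rw [Filter.eventually_all]
    intro l
    obtain ⟨a, b, hb, h⟩ := hfrac (f' (X' l))
    obtain ⟨η, h1, h2⟩ := hadj b
    obtain ⟨η', h1', h2'⟩ := hadj a
    have hη : IsUnit (mk η) := h1 ▸ (((map_ne_zero_iff f hf).mpr hb).isUnit.map Ψ)
    have h3 : mk (η * fun j => fj j (Xj' j l)) = mk η' := by
      rw [map_mul, h1, h1', ← h, map_mul, hΨ]
      congr 1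
      exact (hg' l).symm
    filter_upwards [h2, h2', eventuallyEqCon_isUnit_iff.mp hη, eventuallyEqCon_mk_eq.mp h3]
      with j h2 h2' h4 h3
    exact ⟨η j, h2, η' j, h2', h4, h3⟩
  filter_upwards [hrel, hgen] with j hrel hgen
  obtain ⟨α, hα⟩ := (hXj j).lift _ _ hrel
  refine ⟨α, fun l => ?_⟩
  have hrange : ∀ x ∈ Algebra.adjoin (k j) (Set.range fun i => ξ i j), ∃ a, α a = x := by
    have : Algebra.adjoin (k j) (Set.range fun i => ξ i j) ≤ α.range := by
      rw [Algebra.adjoin_le_iff]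
      rintro _ ⟨i, rfl⟩
      exact ⟨Xj j i, hα i⟩
    exact this
  obtain ⟨_, hτ, _, hw, h0, h⟩ := hgen l
  obtain ⟨τ, rfl⟩ := hrange _ hτ
  obtain ⟨w, rfl⟩ := hrange _ hw
  exact ⟨τ, w, h0, h⟩

end limit

section criteria

variable {F ι A : Type*} [Field F] [Ring A] [Algebra F A] {X : ι → A}

/-- Applying products of the first order operators `D i + ℓ i` to `1` gives a symbol map. -/
theorem isSymbol_of_operators {W : Type*} [CommRing W] [Algebra F W] (ρ : A →ₐ[F] Module.End F W)
    (D : ι → Derivation F W W) (ℓ : ι → W) (hρ : ∀ i w, ρ (X i) w = D i w + ℓ i * w)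
    (V : Submodule F W) (hV : 1 ∈ V) (hD : ∀ i, ∀ w ∈ V, D i w ∈ V) (hℓ : ∀ i, ℓ i ∈ V)
    (ε : W →ₐ[F] MvPolynomial ι F) (hεV : ∀ w ∈ V, ε w ∈ degLT F ι 2)
    (hε : ∀ i, ε (ℓ i) = MvPolynomial.X i) :
    IsSymbol X (ε.toLinearMap ∘ₗ LinearMap.applyₗ 1 ∘ₗ ρ.toLinearMap) := by
  have hDpow : ∀ i d, ∀ w ∈ V ^ d, D i w ∈ V ^ d := by
    intro i d
    induction d with
    | zero =>
      intro w hw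
      rw [pow_zero] at hw ⊢
      obtain ⟨c, rfl⟩ := Submodule.mem_one.mp hw
      rw [Derivation.map_algebraMap]
      exact zero_mem _
    | succ d ih =>
      intro w hw
      rw [pow_succ] at hw ⊢
      induction hw using Submodule.mul_induction_on' with
      | mem_mul_mem m hm v hv =>
        rw [Derivation.leibniz, smul_eq_mul, smul_eq_mul, mul_comm v]
        exact add_mem (Submodule.mul_mem_mul hm (hD i v hv)) (Submodule.mul_mem_mul (ih m hm) hv)
      | add x _ y _ hx hy =>
        rw [map_add]
        exact add_mem hx hy
  have hεpow : ∀ d, ∀ w ∈ V ^ d, ε w ∈ degLT F ι (d + 1) := by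
    intro d
    induction d with
    | zero =>
      intro w hw
      rw [pow_zero] at hw
      obtain ⟨c, rfl⟩ := Submodule.mem_one.mp hw
      rw [AlgHom.commutes]
      exact C_mem_degLT c
    | succ d ih =>
      intro w hw
      rw [pow_succ] at hw
      induction hw using Submodule.mul_induction_on' with
      | mem_mul_mem m hm v hv =>
        rw [map_mul]
        exact mul_mem_degLT (ih m hm) (hεV v hv)
      | add x _ y _ hx hy =>
        rw [map_add]
        exact add_mem hx hy
  have hℓprod : ∀ l : List ι, (l.map ℓ).prod ∈ V ^ l.length := by
    intro l
    induction l with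
    | nil => exact Submodule.one_le.mp (pow_zero V).ge
    | cons i l ih =>
      rw [List.map_cons, List.prod_cons, List.length_cons, pow_succ']
      exact Submodule.mul_mem_mul (hℓ i) ih
  have hmono : ∀ d, V ^ d ≤ V ^ (d + 1) := fun d w hw => by
    rw [pow_succ, ← mul_one w]
    exact Submodule.mul_mem_mul hw hV
  have key : ∀ l : List ι, ρ (l.map X).prod 1 - (l.map ℓ).prod ∈ V ^ (l.length - 1) := by
    intro l
    induction l with
    | nil => simp
    | cons i l ih =>
      have h1 : ρ ((i :: l).map X).prod 1 - ((i :: l).map ℓ).prod =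
          D i (ρ (l.map X).prod 1) + ℓ i * (ρ (l.map X).prod 1 - (l.map ℓ).prod) := by
        rw [List.map_cons, List.prod_cons, map_mul, Module.End.mul_apply, hρ, List.map_cons,
          List.prod_cons, mul_sub, add_sub_assoc]
      rw [h1, List.length_cons, Nat.add_sub_cancel]
      rcases l with _ | ⟨j, l⟩
      · simp
      · rw [List.length_cons, Nat.add_sub_cancel] at ih
        refine add_mem (hDpow i _ _ ?_) ?_
        · have := add_mem (hmono _ ih) (hℓprod (j :: l))
          rwa [sub_add_cancel] at this
        · rw [List.length_cons, pow_succ']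
          exact Submodule.mul_mem_mul (hℓ i) ih
  intro l
  change ε (ρ (l.map X).prod 1) - _ ∈ _
  rcases l with _ | ⟨i, l⟩
  · simp
  · have h1 : ε ((i :: l).map ℓ).prod = ((i :: l).map MvPolynomial.X).prod := by
      rw [map_list_prod, List.map_map]
      exact congrArg List.prod (List.map_congr_left fun i _ => hε i)
    rw [← h1, ← map_sub]
    exact hεpow _ _ (key (i :: l))

theorem commutator_iterate_charP [Nontrivial A] {p : ℕ} [Fact p.Prime] [CharP F p] (a x : A) :
    (fun y => a * y - y * a)^[p] x = a ^ p * x - x * a ^ p := by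
  have : CharP (Module.End F A) p := charP_of_injective_algebraMap' F p
  have h := sub_pow_expChar_of_commute (p := p)
    (show Commute (LinearMap.mulLeft F a) (LinearMap.mulRight F a) from
      LinearMap.ext fun x => (mul_assoc a x a).symm)
  have h1 : (fun y => a * y - y * a) = ⇑(LinearMap.mulLeft F a - LinearMap.mulRight F a) := rfl
  rw [h1, ← Module.End.pow_apply, h, LinearMap.pow_mulLeft, LinearMap.pow_mulRight]
  rfl

/-- In characteristic `p`, elements `X i ^ p - y i` with `y i` of degree one are central as soon as
the `p`-th power of the commutator with `X i` is the commutator with `y i`. -/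
theorem exists_isFiniteOverCentral_of_commutator [Finite ι] {Φ : A →ₗ[F] MvPolynomial ι F}
    (hX : IsQuasiPoly F X) (hΦ : IsSymbol X Φ) {p : ℕ} [Fact p.Prime] [CharP F p] (y : ι → A)
    (hy : ∀ i, y i ∈ filt F X 1)
    (hXy : ∀ i j, (fun x => X i * x - x * X i)^[p] (X j) = y i * X j - X j * y i) :
    ∃ Z : MvPolynomial ι F →ₐ[F] A, IsFiniteOverCentral Z := by
  have hp := Fact.out (p := p.Prime)
  have := hΦ.nontrivial
  refine exists_isFiniteOverCentral hX hΦ hp.pos (z := fun i => X i ^ p - y i) (fun i a => ?_)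
    fun i => ?_
  · have hle : Algebra.adjoin F (Set.range X) ≤ Subalgebra.centralizer F {X i ^ p - y i} := by
      rw [Algebra.adjoin_le_iff]
      rintro _ ⟨j, rfl⟩
      rw [SetLike.mem_coe, Subalgebra.mem_centralizer_iff]
      rintro _ rfl
      have h1 := hXy i j
      rw [commutator_iterate_charP (F := F)] at h1
      rw [sub_eq_sub_iff_sub_eq_sub] at h1
      rw [sub_mul, mul_sub, h1]
    rw [hX.adjoin_eq_top] at hle
    exact (Subalgebra.mem_centralizer_iff F).mp (hle Algebra.mem_top) _ rfl
  · rw [sub_sub_cancel]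
    exact filt_mono (by have := hp.two_le; omega) (hy i)

end criteria

section weyl

variable {r s : ℕ}

/-- The generators of `WeylPolyAlgebra F r s`, as a sum of finite types. -/
def weylPolyGenEquiv (r s : ℕ) : WeylPolyGen r s ≃ Fin r ⊕ Fin r ⊕ Fin s where
  toFun
    | .u i => .inl i
    | .v i => .inr (.inl i)
    | .y a => .inr (.inr a)
  invFun
    | .inl i => .u i
    | .inr (.inl i) => .v i
    | .inr (.inr a) => .y a
  left_inv z := by cases z <;> rfl
  right_inv z := by rcases z with _ | _ | _ <;> rfl

instance : Fintype (WeylPolyGen r s) := Fintype.ofEquiv _ (weylPolyGenEquiv r s).symm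

/-- The bilinear form pairing `u i` with `v i`. -/
def weylPairing : WeylPolyGen r s → WeylPolyGen r s → ℤ
  | .u i, .v j => if i = j then 1 else 0
  | _, _ => 0

/-- The commutators of the generators of `WeylPolyAlgebra F r s`. -/
def weylForm (x y : WeylPolyGen r s) : ℤ :=
  weylPairing x y - weylPairing y x

variable (F : Type) [Field F]

/-- The generators of `WeylPolyAlgebra F r s`, as elements of it. -/
def weylGen (r s : ℕ) (z : WeylPolyGen r s) : WeylPolyAlgebra F r s :=
  RingQuot.mkAlgHom F (WeylPolyRel F r s) (FreeAlgebra.ι F z)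

theorem isPresented_weylGen (r s : ℕ) : IsPresented F 0 weylForm (weylGen F r s) where
  rel := by
    have key := fun {x y} (h : WeylPolyRel F r s x y) => RingQuot.mkAlgHom_rel F h
    intro x y
    simp only [Pi.zero_apply, Int.cast_zero, zero_mul, Finset.sum_const_zero, zero_add,
      sub_eq_iff_eq_add]
    have hc : ∀ a z, weylGen F r s (.y a) * weylGen F r s z =
        weylGen F r s z * weylGen F r s (.y a) := fun a z => by
      have := key (.central a z)
      rwa [map_mul, map_mul] at this
    have huu : ∀ i j, weylGen F r s (.u i) * weylGen F r s (.u j) =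
        weylGen F r s (.u j) * weylGen F r s (.u i) := fun i j => by
      have := key (.uu i j)
      rwa [map_mul, map_mul] at this
    have hvv : ∀ i j, weylGen F r s (.v i) * weylGen F r s (.v j) =
        weylGen F r s (.v j) * weylGen F r s (.v i) := fun i j => by
      have := key (.vv i j)
      rwa [map_mul, map_mul] at this
    have huv : ∀ i j, weylGen F r s (.u i) * weylGen F r s (.v j) =
        weylGen F r s (.v j) * weylGen F r s (.u i) + if i = j then 1 else 0 := fun i j => by
      have := key (.uv (s := s) i j)
      rw [map_mul, map_add, map_mul, apply_ite (RingQuot.mkAlgHom F _), map_one, map_zero] at this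
      exact this
    rcases x with i | i | a <;> rcases y with j | j | b
    · rw [huu]
      simp [weylForm, weylPairing]
    · rw [huv, add_comm]
      simp [weylForm, weylPairing]
    · rw [hc]
      simp [weylForm, weylPairing]
    · rw [huv]
      by_cases hij : j = i <;> simp [weylForm, weylPairing, hij]
    · rw [hvv]
      simp [weylForm, weylPairing]
    all_goals
      rw [hc]
      simp [weylForm, weylPairing]
  adjoin_eq_top := by
    have h : Set.range (weylGen F r s) =
        RingQuot.mkAlgHom F (WeylPolyRel F r s) '' Set.range (FreeAlgebra.ι F) := by
      rw [← Set.range_comp]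
      rfl
    rw [h, ← AlgHom.map_adjoin, FreeAlgebra.adjoin_range_ι, Algebra.map_top,
      AlgHom.range_eq_top]
    exact RingQuot.mkAlgHom_surjective F _
  lift B _ _ Y hY := by
    have hY' : ∀ i j, Y i * Y j = Y j * Y i + (weylForm i j : B) := fun i j => by
      have := hY i j
      simp only [Pi.zero_apply, Int.cast_zero, zero_mul, Finset.sum_const_zero, zero_add,
        sub_eq_iff_eq_add'] at this
      exact this
    refine ⟨RingQuot.liftAlgHom F ⟨FreeAlgebra.lift F Y, fun x y h => ?_⟩, fun i => ?_⟩
    · induction h with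
      | uu i j => simpa [weylForm, weylPairing] using hY' (.u i) (.u j)
      | vv i j => simpa [weylForm, weylPairing] using hY' (.v i) (.v j)
      | uv i j =>
        rw [map_add, apply_ite (FreeAlgebra.lift F Y)]
        simpa [weylForm, weylPairing] using hY' (.u i) (.v j)
      | central a z => cases z <;> simpa [weylForm, weylPairing] using hY' (.y a) _
    · rw [weylGen, RingQuot.liftAlgHom_mkAlgHom_apply, FreeAlgebra.lift_ι_apply]

theorem exists_isSymbol_weylGen (r s : ℕ) :
    ∃ Φ : WeylPolyAlgebra F r s →ₗ[F] MvPolynomial (WeylPolyGen r s) F,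
      IsSymbol (weylGen F r s) Φ := by
  let W := MvPolynomial (WeylPolyGen r s) F
  let D : WeylPolyGen r s → Derivation F W W := fun i =>
    MvPolynomial.mkDerivation F fun j => (weylPairing i j : W)
  have hDX : ∀ i j, D i (MvPolynomial.X j) = (weylPairing i j : W) := fun i j =>
    MvPolynomial.mkDerivation_X _ _ _
  have hDD : ∀ i j w, D i (D j w) = D j (D i w) := fun i j w => by
    have : ⁅D i, D j⁆ = 0 := MvPolynomial.derivation_ext fun l => by
      simp [Derivation.commutator_apply, hDX]
    rw [← sub_eq_zero, ← Derivation.commutator_apply, this, Derivation.zero_apply]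
  obtain ⟨ρ, hρ⟩ := (isPresented_weylGen F r s).lift (Module.End F W)
    (fun i => (D i).toLinearMap + LinearMap.mulLeft F (MvPolynomial.X i)) fun i j => by
      refine LinearMap.ext fun w => ?_
      simp [hDX, hDD i j, weylForm]
      ring
  refine ⟨_, isSymbol_of_operators ρ D MvPolynomial.X (fun i w => by rw [hρ]; rfl)
    (Submodule.span F (insert 1 (Set.range MvPolynomial.X))) (Submodule.subset_span (.inl rfl))
    (fun i => ?_) (fun i => Submodule.subset_span (.inr ⟨i, rfl⟩)) (AlgHom.id F W)
    (Submodule.span_le.mpr ?_) fun i => rfl⟩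
  · refine fun w hw => (Submodule.span_le (p := Submodule.comap (D i).toLinearMap
      (Submodule.span F (insert 1 (Set.range MvPolynomial.X))))).mpr ?_ hw
    rintro _ (rfl | ⟨j, rfl⟩)
    · simp
    · simp only [Submodule.comap_coe, Set.mem_preimage, Derivation.coeFn_coe, hDX, SetLike.mem_coe]
      rw [← zsmul_one]
      exact zsmul_mem (Submodule.subset_span (.inl rfl)) _
  · rintro _ (rfl | ⟨j, rfl⟩)
    · exact degLT_mono one_le_two (C_mem_degLT 1)
    · exact X_mem_degLT j

theorem exists_isFiniteOverCentral_weylPolyAlgebra (r s : ℕ) {p : ℕ} [Fact p.Prime] [CharP F p] :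
    ∃ Z : MvPolynomial (WeylPolyGen r s) F →ₐ[F] WeylPolyAlgebra F r s,
      IsFiniteOverCentral Z := by
  obtain ⟨Φ, hΦ⟩ := exists_isSymbol_weylGen F r s
  refine exists_isFiniteOverCentral_of_commutator (isPresented_weylGen F r s).isQuasiPoly hΦ
    (p := p) 0 (fun i => zero_mem _) fun i j => ?_
  obtain ⟨q, hq⟩ := Nat.exists_eq_add_of_le (Fact.out (p := p.Prime)).two_le
  have h := (isPresented_weylGen F r s).rel i j
  simp only [Pi.zero_apply, Int.cast_zero, zero_mul, Finset.sum_const_zero, zero_add] at h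
  have h0 : (fun x => weylGen F r s i * x - x * weylGen F r s i) 0 = 0 := by simp
  rw [hq, add_comm, Function.iterate_add_apply, Function.iterate_succ_apply,
    Function.iterate_one]
  simp only [h, Int.cast_comm, sub_self]
  rw [Function.iterate_fixed h0]
  simp

end weyl

section enveloping

variable {F L ι : Type} [Field F] [LieRing L] [LieAlgebra F L] [Fintype ι]

attribute [local instance] LieRing.ofAssociativeRing

theorem isPresented_universalEnvelopingAlgebra (b : Module.Basis ι F L) (c : ι → ι → ι → ℤ)
    (hc : ∀ i j, ⁅b i, b j⁆ = ∑ l, (c i j l : F) • b l) :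
    IsPresented F c 0 fun i => UniversalEnvelopingAlgebra.ι F (b i) where
  rel i j := by
    rw [← LieRing.of_associative_ring_bracket, ← LieHom.map_lie, hc, map_sum]
    simp [Int.cast_smul_eq_zsmul]
  adjoin_eq_top := by
    set S := Algebra.adjoin F (Set.range fun i => UniversalEnvelopingAlgebra.ι F (b i)) with hS
    have hmem : ∀ x : L, UniversalEnvelopingAlgebra.ι F x ∈ S := fun x => by
      have h : (⊤ : Submodule F L) ≤
          S.toSubmodule.comap (UniversalEnvelopingAlgebra.ι F : L →ₗ⁅F⁆ _).toLinearMap := by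
        rw [← b.span_eq, Submodule.span_le]
        rintro _ ⟨i, rfl⟩
        exact Algebra.subset_adjoin ⟨i, rfl⟩
      exact h Submodule.mem_top
    let g : L →ₗ⁅F⁆ S :=
      { toFun := fun x => ⟨UniversalEnvelopingAlgebra.ι F x, hmem x⟩
        map_add' := fun x y => Subtype.ext (map_add _ x y)
        map_smul' := fun a x => Subtype.ext (map_smul _ a x)
        map_lie' := fun {x y} => Subtype.ext (LieHom.map_lie _ x y) }
    have h : S.val.comp (UniversalEnvelopingAlgebra.lift F g) = AlgHom.id F _ :=
      UniversalEnvelopingAlgebra.hom_ext F (LieHom.ext fun x => by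
        change S.val (UniversalEnvelopingAlgebra.lift F g (UniversalEnvelopingAlgebra.ι F x)) = _
        rw [UniversalEnvelopingAlgebra.lift_ι_apply]
        rfl)
    rw [eq_top_iff]
    intro a _
    rw [← AlgHom.id_apply (R := F) a, ← h]
    exact (UniversalEnvelopingAlgebra.lift F g a).2
  lift B _ _ Y hY := by
    have h : ∀ x y, b.constr F Y ⁅x, y⁆ = ⁅b.constr F Y x, b.constr F Y y⁆ := by
      have : (LieModule.toEnd F L L : L →ₗ[F] Module.End F L).compr₂ (b.constr F Y) =
          LinearMap.compl₁₂ (LieModule.toEnd F B B : B →ₗ[F] Module.End F B)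
            (b.constr F Y) (b.constr F Y) := by
        refine b.ext fun i => b.ext fun j => ?_
        have := hY i j
        simp only [Pi.zero_apply, Int.cast_zero, add_zero] at this
        change b.constr F Y ⁅b i, b j⁆ = ⁅b.constr F Y (b i), b.constr F Y (b j)⁆
        rw [b.constr_basis, b.constr_basis, LieRing.of_associative_ring_bracket, this, hc, map_sum]
        simp only [Int.cast_smul_eq_zsmul, map_zsmul, b.constr_basis, zsmul_eq_mul]
      exact fun x y => LinearMap.congr_fun₂ this x y
    refine ⟨UniversalEnvelopingAlgebra.lift F
      { b.constr F Y with map_lie' := fun {x y} => h x y }, fun i => ?_⟩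
    rw [UniversalEnvelopingAlgebra.lift_ι_apply]
    exact b.constr_basis F Y i

end enveloping

section specialLinear

open LieAlgebra.SpecialLinear

variable {m : Type} [DecidableEq m]

/-- The positions of the matrix entries other than the diagonal entry at `o`. -/
abbrev SlIndex (o : m) : Type := {q : m × m // q ≠ (o, o)}

/-- The basis matrices of `sl`: off-diagonal matrix units, and differences of diagonal ones. -/
def slMatrix (R : Type) [Ring R] {o : m} (q : SlIndex o) : Matrix m m R :=
  Matrix.single q.1.1 q.1.2 1 - if q.1.1 = q.1.2 then Matrix.single o o 1 else 0

theorem slMatrix_apply {R : Type} [Ring R] {o : m} (q r : SlIndex o) :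
    slMatrix R q r.1.1 r.1.2 = if r = q then 1 else 0 := by
  have h : ¬(o = r.1.1 ∧ o = r.1.2) := fun h => r.2 (Prod.ext h.1.symm h.2.symm)
  have h' : (if q.1.1 = q.1.2 then Matrix.single o o (1 : R) else 0) r.1.1 r.1.2 = 0 := by
    split_ifs
    · rw [Matrix.single_apply, if_neg h]
    · rfl
  rw [slMatrix, Matrix.sub_apply, h', sub_zero, Matrix.single_apply]
  refine if_congr ?_ rfl rfl
  rw [Subtype.ext_iff, Prod.ext_iff]
  exact ⟨fun h => ⟨h.1.symm, h.2.symm⟩, fun h => ⟨h.1.symm, h.2.symm⟩⟩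

variable [Fintype m]

theorem trace_slMatrix {R : Type} [Ring R] {o : m} (q : SlIndex o) :
    (slMatrix R q).trace = 0 := by
  rw [slMatrix, Matrix.trace_sub]
  split_ifs with h
  · rw [h, Matrix.trace_single_eq_same, Matrix.trace_single_eq_same, sub_self]
  · rw [Matrix.trace_single_eq_of_ne _ _ _ h, Matrix.trace_zero, sub_zero]

variable (F : Type) [Field F] (o : m)

/-- The coordinates of a trace zero matrix. -/
def slCoord : sl m F →ₗ[F] SlIndex o → F where
  toFun M q := M.1 q.1.1 q.1.2
  map_add' _ _ := rfl
  map_smul' _ _ := rfl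

variable {F} in
theorem mem_sl_iff {M : Matrix m m F} : M ∈ sl m F ↔ M.trace = 0 :=
  LinearMap.mem_ker

theorem slCoord_bijective : Function.Bijective (slCoord F o) := by
  constructor
  · rw [← LinearMap.ker_eq_bot, LinearMap.ker_eq_bot']
    intro M hM
    have h : ∀ i j, (i, j) ≠ (o, o) → M.1 i j = 0 := fun i j hij => congrFun hM ⟨(i, j), hij⟩
    have ho : M.1 o o = 0 := by
      rw [← mem_sl_iff.mp M.2, Matrix.trace, Finset.sum_eq_single o]
      · rfl
      · exact fun i _ hi => h i i fun h => hi (congrArg Prod.fst h)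
      · simp
    refine Subtype.ext (Matrix.ext fun i j => ?_)
    by_cases hij : (i, j) = (o, o)
    · obtain ⟨rfl, rfl⟩ := Prod.mk.inj hij
      exact ho
    · exact h i j hij
  · intro f
    refine ⟨∑ q, f q • ⟨slMatrix F q, mem_sl_iff.mpr (trace_slMatrix q)⟩, ?_⟩
    rw [map_sum]
    ext r
    rw [Finset.sum_apply, Finset.sum_eq_single r]
    · exact (congrArg (f r * ·) (slMatrix_apply r r)).trans (by simp)
    · exact fun q _ hq => (congrArg (f q * ·) (slMatrix_apply q r)).trans (by simp [hq.symm])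
    · simp

/-- The standard basis of `sl`. -/
def slBasis : Module.Basis (SlIndex o) F (sl m F) :=
  .ofEquivFun (.ofBijective (slCoord F o) (slCoord_bijective F o))

theorem slBasis_val (q : SlIndex o) : (slBasis F o q).1 = slMatrix F q := by
  have h : slBasis F o q = ⟨slMatrix F q, mem_sl_iff.mpr (trace_slMatrix q)⟩ := by
    rw [slBasis, Module.Basis.coe_ofEquivFun, LinearEquiv.symm_apply_eq]
    ext r
    exact (Pi.single_apply ..).trans (slMatrix_apply q r).symm
  rw [h]

/-- The structure constants of `slBasis`. -/
def slConst (a b l : SlIndex o) : ℤ :=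
  (slMatrix ℤ a * slMatrix ℤ b - slMatrix ℤ b * slMatrix ℤ a) l.1.1 l.1.2

theorem slBasis_lie (a b : SlIndex o) :
    ⁅slBasis F o a, slBasis F o b⁆ = ∑ l, (slConst o a b l : F) • slBasis F o l := by
  have hmap : ∀ q : SlIndex o, slMatrix F q = (Int.castRingHom F).mapMatrix (slMatrix ℤ q) :=
    fun q => by
      have h : ∀ i j : m, (Int.castRingHom F).mapMatrix (Matrix.single i j 1) =
          Matrix.single i j 1 := fun i j => by
        rw [RingHom.mapMatrix_apply, Matrix.map_single, map_one]
      rw [slMatrix, slMatrix, map_sub, h, apply_ite (Int.castRingHom F).mapMatrix, h, map_zero]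
  refine (slBasis F o).equivFun.injective ?_
  ext l
  rw [map_sum]
  simp only [map_smul, Module.Basis.equivFun_self, Finset.sum_apply, Pi.smul_apply, smul_eq_mul,
    mul_ite, mul_one, mul_zero, Finset.sum_ite_eq', Finset.mem_univ, if_true]
  change (⁅slBasis F o a, slBasis F o b⁆ : sl m F).1 l.1.1 l.1.2 = _
  rw [sl_bracket, slBasis_val, slBasis_val, hmap, hmap, ← map_mul, ← map_mul, ← map_sub]
  rfl

/-- The generators of `U(sl)` given by the standard basis. -/
def slGen (q : SlIndex o) : UniversalEnvelopingAlgebra F (sl m F) :=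
  UniversalEnvelopingAlgebra.ι F (slBasis F o q)

theorem isPresented_slGen : IsPresented F (slConst o) 0 (slGen F o) :=
  isPresented_universalEnvelopingAlgebra (slBasis F o) (slConst o) (slBasis_lie F o)

theorem slMatrix_pow {p : ℕ} [Fact p.Prime] [CharP F p] (q : SlIndex o) :
    slMatrix F q ^ p = if q.1.1 = q.1.2 then slMatrix F q else 0 := by
  have hp := Fact.out (p := p.Prime)
  obtain ⟨⟨i, j⟩, hq⟩ := q
  simp only [slMatrix]
  split_ifs with h
  · have hio : i ≠ o := by
      rintro rfl
      exact hq (Prod.ext rfl h.symm)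
    obtain rfl : i = j := h
    have : Nonempty m := ⟨o⟩
    have : CharP (Matrix m m F) p := charP_of_injective_algebraMap' F p
    have hid : ∀ k : m, Matrix.single k k (1 : F) ^ p = Matrix.single k k 1 := fun k =>
      IsIdempotentElem.pow_eq (by simp [IsIdempotentElem]) hp.ne_zero
    rw [sub_pow_expChar_of_commute, hid, hid]
    simp [Commute, SemiconjBy, hio, hio.symm]
  · have h : j ≠ i := fun h' => h h'.symm
    have h2 : Matrix.single i j (1 : F) ^ 2 = 0 := by
      rw [pow_two, Matrix.single_mul_single_of_ne _ _ _ _ h]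
    rw [sub_zero]
    exact pow_eq_zero_of_le hp.two_le h2

end specialLinear

section specialLinearSymbol

open LieAlgebra.SpecialLinear MvPolynomial

attribute [local instance] LieRing.ofAssociativeRing

variable {m : Type} [Fintype m] (F : Type) [Field F]

/-- The action of matrices by right translations on functions of a matrix and of parameters
indexed by `ι`. -/
def matrixDerivation (ι : Type) :
    Matrix m m F →ₗ[F] Derivation F (MvPolynomial (m × m ⊕ ι) F) (MvPolynomial (m × m ⊕ ι) F) where
  toFun M := mkDerivation F (Sum.elim (fun q => ∑ i, M i q.2 • X (.inl (q.1, i))) 0)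
  map_add' M N := derivation_ext fun q => by
    rcases q with q | q <;> simp [mkDerivation_X, add_smul, Finset.sum_add_distrib]
  map_smul' a M := derivation_ext fun q => by
    rcases q with q | q <;> simp [mkDerivation_X, mul_smul, Finset.smul_sum]

variable {F}

theorem matrixDerivation_X_inl {ι : Type} (M : Matrix m m F) (j k : m) :
    matrixDerivation F ι M (X (.inl (j, k))) = ∑ i, M i k • X (.inl (j, i)) :=
  mkDerivation_X _ _ _

theorem matrixDerivation_X_inr {ι : Type} (M : Matrix m m F) (q : ι) :
    matrixDerivation F ι M (X (.inr q)) = 0 :=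
  mkDerivation_X _ _ _

theorem matrixDerivation_lie {ι : Type} (M N : Matrix m m F) :
    matrixDerivation F ι (M * N - N * M) = ⁅matrixDerivation F ι M, matrixDerivation F ι N⁆ := by
  refine derivation_ext fun q => ?_
  rw [Derivation.commutator_apply]
  rcases q with ⟨j, k⟩ | q
  · simp only [matrixDerivation_X_inl, map_sum, Derivation.map_smul, Finset.smul_sum, smul_smul,
      Matrix.sub_apply, Matrix.mul_apply, sub_smul, Finset.sum_smul, Finset.sum_sub_distrib]
    rw [Finset.sum_comm, Finset.sum_comm (f := fun i x => (N i x * M x k) • _)]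
    simp only [mul_comm]
  · simp only [matrixDerivation_X_inr, map_zero, sub_zero]

variable [DecidableEq m] (F) (o : m)

/-- The generic linear combination of the entries of a matrix, with parameters as coefficients. -/
def slForm : MvPolynomial (m × m ⊕ SlIndex o) F :=
  ∑ q : SlIndex o, X (.inl q.1) * X (.inr q)

/-- The action of `sl` by right translations, twisted by the exponential of `slForm`. -/
def slRep : sl m F →ₗ⁅F⁆ Module.End F (MvPolynomial (m × m ⊕ SlIndex o) F) where
  toFun M := (matrixDerivation F _ M.1).toLinearMap +
    LinearMap.mulLeft F (matrixDerivation F _ M.1 (slForm F o))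
  map_add' M N := LinearMap.ext fun w => by
    simp [add_mul]
    ring
  map_smul' a M := LinearMap.ext fun w => by
    simp
  map_lie' {M N} := LinearMap.ext fun w => by
    rw [LieRing.of_associative_ring_bracket]
    simp only [sl_bracket, matrixDerivation_lie, Derivation.commutator_apply, LinearMap.add_apply,
      LinearMap.sub_apply, Derivation.coeFn_coe, LinearMap.mulLeft_apply, Module.End.mul_apply,
      map_add, Derivation.leibniz, smul_eq_mul]
    ring

theorem exists_isSymbol_slGen :
    ∃ Φ : UniversalEnvelopingAlgebra F (sl m F) →ₗ[F] MvPolynomial (SlIndex o) F,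
      IsSymbol (slGen F o) Φ := by
  let δ := matrixDerivation (m := m) F (SlIndex o)
  let S : Subalgebra F (MvPolynomial (m × m ⊕ SlIndex o) F) :=
    Algebra.adjoin F (Set.range fun q : m × m => X (.inl q))
  let T : Submodule F (MvPolynomial (m × m ⊕ SlIndex o) F) :=
    Submodule.span F (insert 1 (Set.range fun q => X (.inr q)))
  let ε : MvPolynomial (m × m ⊕ SlIndex o) F →ₐ[F] MvPolynomial (SlIndex o) F :=
    aeval (Sum.elim (fun q => if q.1 = q.2 then 1 else 0) X)
  have hεl : ∀ q, ε (X (.inl q)) = if q.1 = q.2 then 1 else 0 := fun q => aeval_X _ _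
  have hεr : ∀ q, ε (X (.inr q)) = X q := fun q => aeval_X _ _
  have hXS : ∀ q, X (.inl q) ∈ S := fun q => Algebra.subset_adjoin ⟨q, rfl⟩
  have hS : ∀ M, ∀ w ∈ S, δ M w ∈ S := by
    intro M w hw
    induction hw using Algebra.adjoin_induction with
    | mem x hx =>
      obtain ⟨⟨j, k⟩, rfl⟩ := hx
      rw [matrixDerivation_X_inl]
      exact sum_mem fun i _ => S.smul_mem (hXS _) _
    | algebraMap r =>
      rw [Derivation.map_algebraMap]
      exact zero_mem _
    | add x y _ _ hx hy =>
      rw [map_add]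
      exact add_mem hx hy
    | mul x y hx' hy' hx hy =>
      rw [Derivation.leibniz, smul_eq_mul, smul_eq_mul]
      exact add_mem (mul_mem hx' hy) (mul_mem hy' hx)
  have hT : ∀ M, ∀ w ∈ T, δ M w = 0 := by
    intro M w hw
    refine (Submodule.span_le (p := LinearMap.ker (δ M).toLinearMap)).mpr ?_ hw
    rintro _ (rfl | ⟨q, rfl⟩)
    · simp
    · exact matrixDerivation_X_inr M q
  have hD : ∀ M, ∀ w ∈ S.toSubmodule * T, δ M w ∈ S.toSubmodule * T := by
    intro M w hw
    induction hw using Submodule.mul_induction_on' with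
    | mem_mul_mem a ha t ht =>
      rw [Derivation.leibniz, hT M t ht, smul_zero, zero_add, smul_eq_mul, mul_comm t]
      exact Submodule.mul_mem_mul (hS M a ha) ht
    | add x _ y _ hx hy =>
      rw [map_add]
      exact add_mem hx hy
  have hε1 : ∀ a ∈ S, ε a ∈ degLT F (SlIndex o) 1 := by
    intro a ha
    have : S ≤ Subalgebra.comap ε ⊥ := by
      rw [Algebra.adjoin_le_iff]
      rintro _ ⟨q, rfl⟩
      rw [SetLike.mem_coe, Subalgebra.mem_comap, hεl]
      split_ifs
      exacts [one_mem _, zero_mem _]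
    obtain ⟨c, hc⟩ := Algebra.mem_bot.mp (this ha)
    exact hc ▸ C_mem_degLT c
  have hε2 : ∀ t ∈ T, ε t ∈ degLT F (SlIndex o) 2 := by
    intro t ht
    refine (Submodule.span_le (p := Submodule.comap ε.toLinearMap (degLT F _ 2))).mpr ?_ ht
    rintro _ (rfl | ⟨q, rfl⟩)
    · exact (map_one ε ▸ degLT_mono one_le_two (C_mem_degLT 1) : ε 1 ∈ degLT F _ 2)
    · exact (hεr q ▸ X_mem_degLT q : ε (X (.inr q)) ∈ degLT F _ 2)
  have hform : slForm F o ∈ S.toSubmodule * T := sum_mem fun q _ =>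
    Submodule.mul_mem_mul (hXS _) (Submodule.subset_span (.inr ⟨q, rfl⟩))
  refine ⟨_, isSymbol_of_operators (UniversalEnvelopingAlgebra.lift F (slRep F o))
    (fun q => δ (slBasis F o q).1) (fun q => δ (slBasis F o q).1 (slForm F o)) (fun q w => ?_)
    (S.toSubmodule * T) ?_ (fun q => hD _) (fun q => hD _ _ hform) ε (fun w hw => ?_)
    fun q => ?_⟩
  · rw [slGen, UniversalEnvelopingAlgebra.lift_ι_apply]
    rfl
  · rw [← one_mul (1 : MvPolynomial (m × m ⊕ SlIndex o) F)]
    exact Submodule.mul_mem_mul (one_mem S) (Submodule.subset_span (.inl rfl))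
  · induction hw using Submodule.mul_induction_on' with
    | mem_mul_mem a ha t ht =>
      rw [map_mul]
      exact mul_mem_degLT (hε1 a ha) (hε2 t ht)
    | add x _ y _ hx hy =>
      rw [map_add]
      exact add_mem hx hy
  · have h : ∀ r : SlIndex o, ε (δ (slMatrix F q) (X (.inl r.1) * X (.inr r))) =
        if r = q then X r else 0 := fun r => by
      rw [Derivation.leibniz, matrixDerivation_X_inr, smul_zero, zero_add, ← Prod.eta r.1,
        matrixDerivation_X_inl, smul_eq_mul, map_mul, map_sum]
      simp only [map_smul, hεl, hεr, smul_ite, smul_zero, Finset.sum_ite_eq, Finset.mem_univ,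
        if_true, slMatrix_apply]
      split_ifs <;> simp
    rw [slBasis_val, slForm, map_sum, map_sum, Finset.sum_congr rfl fun r _ => h r]
    simp

theorem exists_isFiniteOverCentral_sl {p : ℕ} [Fact p.Prime] [CharP F p] :
    ∃ Z : MvPolynomial (SlIndex o) F →ₐ[F] UniversalEnvelopingAlgebra F (sl m F),
      IsFiniteOverCentral Z := by
  obtain ⟨Φ, hΦ⟩ := exists_isSymbol_slGen F o
  refine exists_isFiniteOverCentral_of_commutator (isPresented_slGen F o).isQuasiPoly hΦ
    (p := p) (fun i => if i.1.1 = i.1.2 then slGen F o i else 0) (fun i => ?_) fun i j => ?_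
  · split_ifs
    exacts [gen_mem_filt i, zero_mem _]
  have : Nonempty m := ⟨o⟩
  have h1 : ∀ (k : ℕ) (x : sl m F),
      (fun x => slGen F o i * x - x * slGen F o i)^[k] (UniversalEnvelopingAlgebra.ι F x) =
        UniversalEnvelopingAlgebra.ι F ((fun x => ⁅slBasis F o i, x⁆)^[k] x) := by
    intro k
    induction k with
    | zero => exact fun x => rfl
    | succ k ih =>
      intro x
      rw [Function.iterate_succ_apply, Function.iterate_succ_apply, ← ih, LieHom.map_lie]
      rfl
  have h2 : ∀ (k : ℕ) (x : sl m F), ((fun x => ⁅slBasis F o i, x⁆)^[k] x).1 =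
      (fun x => slMatrix F i * x - x * slMatrix F i)^[k] x.1 := by
    intro k
    induction k with
    | zero => exact fun x => rfl
    | succ k ih =>
      intro x
      rw [Function.iterate_succ_apply, Function.iterate_succ_apply, ih, sl_bracket, slBasis_val]
  have h3 := h2 p (slBasis F o j)
  rw [commutator_iterate_charP (F := F), slMatrix_pow] at h3
  have h4 : (fun x => slGen F o i * x - x * slGen F o i)^[p] (slGen F o j) = _ :=
    h1 p (slBasis F o j)
  rw [h4]
  split_ifs with h
  · rw [if_pos h, ← slBasis_val, ← sl_bracket] at h3
    rw [Subtype.ext h3, LieHom.map_lie]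
    rfl
  · rw [if_neg h, zero_mul, mul_zero, sub_zero] at h3
    rw [zero_mul, mul_zero, sub_zero, ← map_zero (UniversalEnvelopingAlgebra.ι F : sl m F →ₗ⁅F⁆ _)]
    exact congrArg _ (Subtype.ext h3)

end specialLinearSymbol

section reduction

open LieAlgebra.SpecialLinear

theorem IsFiniteOverCentral.exists_isFractionDivisionRing {F ι A : Type} [Field F] [Ring A]
    [NoZeroDivisors A] [Nontrivial A] [Algebra F A] {Z : MvPolynomial ι F →ₐ[F] A}
    (hZ : IsFiniteOverCentral Z) :
    ∃ (Q : Type) (_ : DivisionRing Q) (_ : Algebra F Q) (f : A →ₐ[F] Q),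
      IsFractionDivisionRing F f :=
  exists_divisionRing_of_ore fun r _ => hZ.exists_ore r

theorem IsSymbol.linearIndependent {F ι A : Type} [Field F] [Ring A] [Algebra F A] {X : ι → A}
    {Φ : A →ₗ[F] MvPolynomial ι F} (hΦ : IsSymbol X Φ) :
    LinearIndependent F (orderedMonomial X) :=
  .of_comp Φ (linearIndependent_of_symbol hΦ.orderedMonomial_symbol)

theorem gelfandKirillovHolds_of_generatesFractions {F : Type} [Field F] {p : ℕ} [Fact p.Prime]
    [CharP F p] {m : Type} [Fintype m] [DecidableEq m] (o : m) {r s : ℕ} {Q Q' : Type}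
    [DivisionRing Q] [Algebra F Q] [DivisionRing Q'] [Algebra F Q']
    {f : UniversalEnvelopingAlgebra F (sl m F) →ₐ[F] Q} (hf : IsFractionDivisionRing F f)
    {f' : WeylPolyAlgebra F r s →ₐ[F] Q'} (hf' : IsFractionDivisionRing F f')
    {α : UniversalEnvelopingAlgebra F (sl m F) →ₐ[F] Q'}
    (hα : GeneratesFractions α fun l => f' (weylGen F r s l))
    {α' : WeylPolyAlgebra F r s →ₐ[F] Q} (hα' : GeneratesFractions α' fun l => f (slGen F o l)) :
    GelfandKirillovHolds F (sl m F) := by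
  obtain ⟨Z, hZ⟩ := exists_isFiniteOverCentral_sl F o (p := p)
  obtain ⟨Z', hZ'⟩ := exists_isFiniteOverCentral_weylPolyAlgebra F r s (p := p)
  obtain ⟨Φ, hΦ⟩ := exists_isSymbol_slGen F o
  obtain ⟨Φ', hΦ'⟩ := exists_isSymbol_weylGen F r s
  have hX := isPresented_slGen F o
  have hX' := isPresented_weylGen F r s
  have := hΦ.noZeroDivisors hX.isQuasiPoly
  have := hΦ'.noZeroDivisors hX'.isQuasiPoly
  have := hΦ'.nontrivial
  have hinj : Function.Injective α' :=
    (hα'.injective hZ' hZ hX.adjoin_eq_top hf.1 hf.2).2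
      (hα.injective hZ hZ' hX'.adjoin_eq_top hf'.1 hf'.2).1
  exact ⟨
    { r := r
      s := s
      D₁ := Q
      D₂ := Q
      f₁ := f
      f₂ := α'
      frac₁ := hf
      frac₂ := ⟨hinj, exists_mul_eq_of_injective (fun r _ => hZ'.exists_ore r) hinj
        fun _ hS hαS d => hα'.mem hX.adjoin_eq_top hf.1 hf.2 hS hαS d⟩
      iso := AlgEquiv.refl }⟩

/-- A map between fields respects `0`, `1`, and the sum and product of a pair of elements. -/
def PreservesAt {K k : Type} [Field K] [Field k] (θ : K → k) (q : K × K) : Prop :=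
  θ 0 = 0 ∧ θ 1 = 1 ∧ θ (q.1 + q.2) = θ q.1 + θ q.2 ∧ θ (q.1 * q.2) = θ q.1 * θ q.2

theorem isEventualHom_iInf_principal {K J : Type} [Field K] {k : J → Type} [∀ j, Field (k j)]
    (θ : ∀ j, K → k j) :
    IsEventualHom (⨅ q : K × K, Filter.principal {j | PreservesAt (θ j) q}) θ := by
  have h : ∀ q : K × K, ∀ᶠ j in ⨅ q : K × K, Filter.principal {j | PreservesAt (θ j) q},
      PreservesAt (θ j) q := fun q =>
    Filter.mem_iInf_of_mem q (Filter.mem_principal_self _)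
  exact
    { zero := (h 0).mono fun _ h => h.1
      one := (h 0).mono fun _ h => h.2.1
      add := fun x y => (h (x, y)).mono fun _ h => h.2.2.1
      mul := fun x y => (h (x, y)).mono fun _ h => h.2.2.2 }

theorem exists_finset_of_eventually {K J : Type} [Field K] {k : J → Type} [∀ j, Field (k j)]
    {θ : ∀ j, K → k j} {P : J → Prop}
    (h : ∀ᶠ j in ⨅ q : K × K, Filter.principal {j | PreservesAt (θ j) q}, P j) :
    ∃ t : Finset (K × K), ∀ j, (∀ q ∈ t, PreservesAt (θ j) q) → P j := by
  obtain ⟨t, ht, hP⟩ := (Filter.hasBasis_iInf_principal_finite _).eventually_iff.mp h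
  refine ⟨ht.toFinset, fun j hj => hP (Set.mem_iInter₂.mpr fun q hq => hj q ?_)⟩
  exact ht.mem_toFinset.mpr hq

end reduction

/-- **Reduction theorem, instantiated at the special linear Lie algebras.**  If the
Gelfand–Kirillov conjecture holds for `sl_n` over an algebraically closed field `K` of
characteristic `0` (`n ≥ 2`), then there is an `N` such that for every prime `p > N` it
holds for `sl_n` over an algebraic closure of `𝔽_p`. -/
theorem gelfandKirillov_reduction_sl (K : Type) [Field K] [IsAlgClosed K] [CharZero K]
    (n : ℕ) (hn : 2 ≤ n)
    (h : GelfandKirillovHolds K (LieAlgebra.SpecialLinear.sl (Fin n) K)) :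
    ∃ N : ℕ, ∀ (p : ℕ) [Fact p.Prime], N < p →
      GelfandKirillovHolds (AlgebraicClosure (ZMod p))
        (LieAlgebra.SpecialLinear.sl (Fin n) (AlgebraicClosure (ZMod p))) := by
  obtain ⟨r, s, D₁, D₂, f₁, f₂, hf₁, hf₂, iso⟩ := h
  let o : Fin n := ⟨0, by omega⟩
  have hprime : ∀ p : Nat.Primes, Fact (p : ℕ).Prime := fun p => ⟨p.2⟩
  let J := Σ p : Nat.Primes, (K → AlgebraicClosure (ZMod p))
  let k : J → Type := fun j => AlgebraicClosure (ZMod j.1)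
  let _ : ∀ j, Field (k j) := fun j => inferInstanceAs (Field (AlgebraicClosure (ZMod j.1)))
  let θ : ∀ j : J, K → k j := fun j => j.2
  have hX := isPresented_slGen K o
  have hX' := isPresented_weylGen K r s
  have hXj := fun j => isPresented_slGen (k j) o
  have hXj' := fun j => isPresented_weylGen (k j) r s
  obtain ⟨Φ, hΦ⟩ := exists_isSymbol_slGen K o
  obtain ⟨Φ', hΦ'⟩ := exists_isSymbol_weylGen K r s
  choose Φj hΦj using fun j => exists_isSymbol_slGen (k j) o
  choose Φj' hΦj' using fun j => exists_isSymbol_weylGen (k j) r s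
  have := hΦ.nontrivial
  have := hΦ'.nontrivial
  have := hΦ.noZeroDivisors hX.isQuasiPoly
  have := hΦ'.noZeroDivisors hX'.isQuasiPoly
  have := fun j => (hΦj j).nontrivial
  have := fun j => (hΦj' j).nontrivial
  have := fun j => (hΦj j).noZeroDivisors (hXj j).isQuasiPoly
  have := fun j => (hΦj' j).noZeroDivisors (hXj' j).isQuasiPoly
  have hchar : ∀ j : J, CharP (k j) (j.1 : ℕ) := fun j => inferInstance
  choose Q _ _ f hf using fun j =>
    (exists_isFiniteOverCentral_sl (k j) o (p := j.1)).choose_spec.exists_isFractionDivisionRing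
  choose Q' _ _ f' hf' using fun j =>
    (exists_isFiniteOverCentral_weylPolyAlgebra (k j) r s
      (p := j.1)).choose_spec.exists_isFractionDivisionRing
  have hg₁ : IsFractionDivisionRing K ((iso : D₁ →ₐ[K] D₂).comp f₁) :=
    ⟨iso.injective.comp hf₁.1, fun d => by
      obtain ⟨a, b, hb, h⟩ := hf₁.2 (iso.symm d)
      refine ⟨a, b, hb, ?_⟩
      have := congrArg iso h
      rwa [map_mul, AlgEquiv.apply_symm_apply] at this⟩
  have hθ := isEventualHom_iInf_principal θ
  have h₁ := eventually_exists_generatesFractions hθ hX hX' hg₁.1 hg₁.2 hf₂.1 hf₂.2 hXj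
    (fun j => (hXj' j).rel) (fun j => (hΦj' j).linearIndependent) (fun j => (hf' j).1)
  have h₂ := eventually_exists_generatesFractions hθ hX' hX hf₂.1 hf₂.2 hg₁.1 hg₁.2 hXj'
    (fun j => (hXj j).rel) (fun j => (hΦj j).linearIndependent) (fun j => (hf j).1)
  obtain ⟨t, ht⟩ := exists_finset_of_eventually <|
    (h₁.and h₂).mono fun j ⟨⟨_, hα⟩, _, hα'⟩ =>
      gelfandKirillovHolds_of_generatesFractions (p := j.1) o (hf j) (hf' j) hα hα'
  obtain ⟨N, hN⟩ := exists_partial_ringHom K t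
  refine ⟨N, fun p hp hNp => ?_⟩
  obtain ⟨θp, h0, h1, hθp⟩ := hN p hNp
  exact ht ⟨⟨p, hp.out⟩, θp⟩ fun q hq => ⟨h0, h1, hθp q hq⟩

end
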